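/- arXiv:1104.4732 — 3 statements merged into one kernel-verified Lean document; each statement's English description precedes it below -/
import Mathlib

section
/- Let p ≥ 2, let k_1,…,k_p ≥ 1 be integers, and let ρ : {1,…,n}² → [0,∞) be a symmetric function. Let γ be a diagram over the table T with rows of lengths k_1,…,k_p, and let ℓ_{uv} denote the number of edges of γ between rows u and v. Define I_{n,T}(γ) := Σ' Π_{1≤u<v≤p} ρ(t_u,t_v)^{ℓ_{uv}}, the sum over p-tuples (t_1,…,t_p) of pairwise distinct indices in {1,…,n}, and for u ≠ v set R_{uv} := ( Σ_{1≤t≤n} ( Σ_{1≤s≤n, s≠t} ρ(s,t)^{k_u} )^{k_v/k_u} )^{ℓ_{uv}/k_v}. Then the Hölder-type inequality I_{n,T}(γ) ≤ min( Π_{1≤u<v≤p} R_{uv}, Π_{1≤u<v≤p} R_{vu} ) holds. -/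
open MeasureTheory Finset Filter
open scoped BigOperators

noncomputable section

/-- A diagram over the table with rows of lengths `k 0, …, k (p-1)`:
a pairing (fixed-point free involution) of the points of the table such that
no pair (edge) lies within a single row. -/
structure Diagram (p : ℕ) (k : Fin p → ℕ) where
  pair : (Σ u : Fin p, Fin (k u)) → (Σ u : Fin p, Fin (k u))
  involutive : ∀ x, pair (pair x) = x
  offRow : ∀ x, (pair x).1 ≠ x.1

/-- The number `ℓ_{uv}` of edges of the diagram joining a point of row `u`
with a point of row `v`. -/
def Diagram.edges {p : ℕ} {k : Fin p → ℕ} (γ : Diagram p k) (u v : Fin p) : ℕ :=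
  (Finset.univ.filter fun x : Σ w : Fin p, Fin (k w) => x.1 = u ∧ (γ.pair x).1 = v).card

/-- **Hölder's inequality** for finite sums of weighted geometric means of finitely many functions,
where zero weights are allowed. -/
theorem sum_prod_rpow_le_prod_sum_rpow {α ι : Type*} [Fintype α] [Fintype ι]
    (f : ι → α → NNReal) (w : ι → ℝ) (hw : ∑ i, w i = 1) (hw0 : ∀ i, 0 ≤ w i) :
    ∑ x, ∏ i, f i x ^ w i ≤ ∏ i, (∑ x, f i x) ^ w i := by
  let _ : MeasurableSpace α := ⊤
  have h := ENNReal.lintegral_prod_norm_pow_le (μ := Measure.count) univ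
    (f := fun i x ↦ (f i x : ENNReal)) (fun i _ ↦ (Measurable.of_discrete).aemeasurable)
    (p := w) hw (fun i _ ↦ hw0 i)
  simp only [lintegral_fintype, Measure.count_singleton, mul_one] at h
  rw [← ENNReal.coe_le_coe]
  push_cast
  simpa [ENNReal.coe_rpow_of_nonneg, hw0] using h

/-- Mixed-norm Hölder inequality for products of pair interactions `r (t u) (t v) ^ ℓ u v` and
one-variable functions `G j u (t u) ^ a j u`, provided the normalised exponents at each
variable `u` sum to `1`. -/
theorem sum_prod_pair_rpow_le_prod_mixed_norm {α : Type*} [Fintype α] (r : α → α → NNReal)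
    (p : ℕ) {J : Type} [Fintype J] (k : Fin p → ℝ) (hk : ∀ u, 0 < k u)
    (ℓ : Fin p → Fin p → ℝ) (hℓ : ∀ u v, 0 ≤ ℓ u v) (hdiag : ∀ u, ℓ u u = 0)
    (hsymm : ∀ u v, ℓ u v = ℓ v u) (G : J → Fin p → α → NNReal) (a : J → Fin p → ℝ)
    (ha : ∀ j u, 0 ≤ a j u) (hsum : ∀ u, ∑ j, a j u + ∑ v, ℓ u v / k u = 1) :
    ∑ t : Fin p → α, (∏ u, ∏ j, G j u (t u) ^ a j u) *
        ∏ u, ∏ v ∈ Ioi u, r (t u) (t v) ^ ℓ u v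
      ≤ (∏ u, ∏ j, (∑ x, G j u x) ^ a j u) *
        ∏ u, ∏ v ∈ Ioi u, (∑ y, (∑ x, r x y ^ k u) ^ (k v / k u)) ^ (ℓ u v / k v) := by
  induction p generalizing J with
  | zero => simp
  | succ p ih =>
    rw [← (Fin.consEquiv fun _ ↦ α).sum_comp, Fintype.sum_prod_type_right]
    simp only [Fin.consEquiv_apply, Fin.prod_univ_succ, Fin.cons_zero, Fin.cons_succ,
      Fin.prod_Ioi_zero, Fin.prod_Ioi_succ]
    let g : Fin p → α → NNReal := fun v y ↦ (∑ x, r x y ^ k 0) ^ (k v.succ / k 0)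
    let G' : Option J → Fin p → α → NNReal := fun j v ↦ j.elim (g v) (fun j ↦ G j v.succ)
    let a' : Option J → Fin p → ℝ := fun j v ↦ j.elim (ℓ 0 v.succ / k v.succ) (fun j ↦ a j v.succ)
    have hrest := ih (fun u ↦ k u.succ) (fun u ↦ hk _) (fun u v ↦ ℓ u.succ v.succ)
      (fun _ _ ↦ hℓ _ _) (fun _ ↦ hdiag _) (fun _ _ ↦ hsymm _ _) G' a'
      (by
        rintro (_ | j) u
        · exact div_nonneg (hℓ _ _) (hk _).le
        · exact ha _ _)
      (by
        intro u
        have := hsum u.succ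
        rw [Fin.sum_univ_succ, hsymm u.succ 0] at this
        simp only [Fintype.sum_option, a', Option.elim]
        linarith)
    simp only [Fintype.prod_option, G', a', g, Option.elim, prod_mul_distrib] at hrest
    have hzero (t : Fin p → α) :
        ∑ x, (∏ j, G j 0 x ^ a j 0) * ∏ v, r x (t v) ^ ℓ 0 v.succ ≤
          (∏ j, (∑ x, G j 0 x) ^ a j 0) *
            ∏ v, ((∑ x, r x (t v) ^ k 0) ^ (k v.succ / k 0)) ^ (ℓ 0 v.succ / k v.succ) := by
      have h := sum_prod_rpow_le_prod_sum_rpow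
        (Sum.elim (fun j ↦ G j 0) (fun (v : Fin p) x ↦ r x (t v) ^ k 0))
        (Sum.elim (fun j ↦ a j 0) (fun v ↦ ℓ 0 v.succ / k 0))
        (by
          have := hsum 0
          rw [Fin.sum_univ_succ, hdiag, zero_div, zero_add] at this
          simpa using this)
        (by
          rintro (j | v)
          · exact ha _ _
          · exact div_nonneg (hℓ _ _) (hk _).le)
      have h0 := (hk 0).ne'
      have e1 (v : Fin p) : k 0 * (ℓ 0 v.succ / k 0) = ℓ 0 v.succ := by field_simp
      have e2 (v : Fin p) : k v.succ / k 0 * (ℓ 0 v.succ / k v.succ) = ℓ 0 v.succ / k 0 := by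
        have := (hk v.succ).ne'
        field_simp
      simpa only [Fintype.prod_sum_type, Sum.elim_inl, Sum.elim_inr, ← NNReal.rpow_mul, e1, e2]
        using h
    calc
      _ = ∑ t : Fin p → α,
          (∑ x, (∏ j, G j 0 x ^ a j 0) * ∏ v, r x (t v) ^ ℓ 0 v.succ) *
            ((∏ u : Fin p, ∏ j, G j u.succ (t u) ^ a j u.succ) *
              ∏ u : Fin p, ∏ v ∈ Ioi u, r (t u) (t v) ^ ℓ u.succ v.succ) := by
        refine sum_congr rfl fun t _ ↦ ?_
        rw [sum_mul]
        exact sum_congr rfl fun x _ ↦ by ring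
      _ ≤ ∑ t : Fin p → α, _ :=
        sum_le_sum fun t _ ↦ mul_le_mul_left (hzero t) _
      _ = (∏ j, (∑ x, G j 0 x) ^ a j 0) * ∑ t : Fin p → α, _ := by
        rw [mul_sum]
        exact sum_congr rfl fun t _ ↦ by rw [mul_assoc, ← mul_assoc (∏ v : Fin p, _)]
      _ ≤ _ := mul_le_mul_right hrest _
      _ = _ := by ring

theorem Diagram.sum_edges {p : ℕ} {k : Fin p → ℕ} (γ : Diagram p k) (u : Fin p) :
    ∑ v, γ.edges u v = k u := by
  have h := card_eq_sum_card_fiberwise (f := fun x ↦ (γ.pair x).1) (t := univ)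
    (s := univ.filter fun x : Σ w : Fin p, Fin (k w) ↦ x.1 = u) (by simp)
  simp only [filter_filter] at h
  simp only [Diagram.edges, ← h]
  rw [← Fintype.card_subtype, Fintype.card_congr (Equiv.sigmaSubtype u)]
  simp

theorem Diagram.edges_symm {p : ℕ} {k : Fin p → ℕ} (γ : Diagram p k) (u v : Fin p) :
    γ.edges u v = γ.edges v u := by
  refine card_nbij' γ.pair γ.pair ?_ ?_ (fun x _ ↦ γ.involutive x) (fun x _ ↦ γ.involutive x) <;>
  · intro x
    simp only [coe_filter, mem_univ, true_and, Set.mem_ofPred_eq, γ.involutive]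
    exact And.symm

theorem Diagram.edges_self {p : ℕ} {k : Fin p → ℕ} (γ : Diagram p k) (u : Fin p) :
    γ.edges u u = 0 := by
  refine card_eq_zero.2 (filter_eq_empty_iff.2 fun x _ h ↦ γ.offRow x (h.2.trans h.1.symm))

theorem prod_filter_lt_eq_prod_Ioi {ι M : Type*} [Fintype ι] [LinearOrder ι]
    [LocallyFiniteOrderTop ι] [CommMonoid M] (f : ι × ι → M) :
    ∏ uv ∈ univ.filter (fun uv : ι × ι ↦ uv.1 < uv.2), f uv = ∏ u, ∏ v ∈ Ioi u, f (u, v) := by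
  rw [prod_filter, Fintype.prod_prod_type]
  refine prod_congr rfl fun u _ ↦ ?_
  rw [← prod_filter, filter_lt_eq_Ioi]

theorem prod_filter_lt_rev {p : ℕ} {M : Type*} [CommMonoid M] (f : Fin p × Fin p → M) :
    ∏ uv ∈ univ.filter (fun uv : Fin p × Fin p ↦ uv.1 < uv.2), f (uv.2.rev, uv.1.rev) =
      ∏ uv ∈ univ.filter (fun uv : Fin p × Fin p ↦ uv.1 < uv.2), f uv :=
  prod_nbij' (fun uv ↦ (uv.2.rev, uv.1.rev)) (fun uv ↦ (uv.2.rev, uv.1.rev))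
    (by simp) (by simp) (by simp) (by simp) (by simp)

/-- Mixed-norm Hölder inequality for a sum over injective tuples, with degrees `k u` and edge
multiplicities `ℓ u v`. -/
theorem sum_injective_prod_pow_le {α : Type*} [Fintype α] [DecidableEq α] {p : ℕ} (k : Fin p → ℕ)
    (hk : ∀ u, 1 ≤ k u) (ρ : α → α → ℝ) (hρ : ∀ s t, 0 ≤ ρ s t) (ℓ : Fin p → Fin p → ℕ)
    (hdiag : ∀ u, ℓ u u = 0) (hsymm : ∀ u v, ℓ u v = ℓ v u) (hsum : ∀ u, ∑ v, ℓ u v = k u) :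
    (∑ t ∈ univ.filter (fun t : Fin p → α ↦ Function.Injective t),
        ∏ uv ∈ univ.filter (fun uv : Fin p × Fin p ↦ uv.1 < uv.2),
          ρ (t uv.1) (t uv.2) ^ ℓ uv.1 uv.2)
      ≤ ∏ uv ∈ univ.filter (fun uv : Fin p × Fin p ↦ uv.1 < uv.2),
          (∑ t, (∑ s ∈ univ.filter (· ≠ t), ρ s t ^ k uv.1)
            ^ ((k uv.2 : ℝ) / (k uv.1 : ℝ))) ^ ((ℓ uv.1 uv.2 : ℝ) / (k uv.2 : ℝ)) := by
  lift ρ to α → α → NNReal using hρ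
  let r : α → α → NNReal := fun s t ↦ if s = t then 0 else ρ s t
  have hkpos (u : Fin p) : (0 : ℝ) < k u := by exact_mod_cast hk u
  have h := sum_prod_pair_rpow_le_prod_mixed_norm r p (J := Empty) (fun u ↦ k u) hkpos
    (fun u v ↦ ℓ u v) (fun _ _ ↦ Nat.cast_nonneg _) (fun u ↦ by simp [hdiag])
    (fun u v ↦ by rw [hsymm]) (fun j ↦ j.elim) (fun j ↦ j.elim) (fun j ↦ j.elim)
    (fun u ↦ by
      rw [← sum_div, ← Nat.cast_sum, hsum, div_self (hkpos u).ne']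
      simp)
  simp only [univ_eq_empty, prod_empty, prod_const_one, one_mul, NNReal.rpow_natCast] at h
  have hinner (u : Fin p) (y : α) :
      ∑ x, r x y ^ k u = ∑ x ∈ univ.filter (· ≠ y), ρ x y ^ k u := by
    rw [sum_filter]
    refine sum_congr rfl fun x _ ↦ ?_
    by_cases hxy : x = y <;> simp [r, hxy, (Nat.one_le_iff_ne_zero.1 (hk u))]
  simp only [hinner] at h
  have hinj : ∑ t ∈ univ.filter (fun t : Fin p → α ↦ Function.Injective t),
      ∏ u, ∏ v ∈ Ioi u, ρ (t u) (t v) ^ ℓ u v ≤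
      ∑ t : Fin p → α, ∏ u, ∏ v ∈ Ioi u, r (t u) (t v) ^ ℓ u v := by
    refine le_trans (le_of_eq (sum_congr rfl fun t ht ↦ ?_))
      (sum_le_sum_of_subset (filter_subset _ _))
    refine prod_congr rfl fun u _ ↦ prod_congr rfl fun v hv ↦ ?_
    have : t u ≠ t v := (mem_filter.1 ht).2.ne (mem_Ioi.1 hv).ne
    simp [r, this]
  simp only [prod_filter_lt_eq_prod_Ioi]
  exact_mod_cast hinj.trans h

/-- Hölder-type inequality for diagram sums, cf. (2.14) of
Bardet–Surgailis. -/
theorem holder_bound_for_diagram_sums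
    (p n : ℕ) (hp : 2 ≤ p) (k : Fin p → ℕ) (hk : ∀ u, 1 ≤ k u)
    (ρ : Fin n → Fin n → ℝ) (hρnn : ∀ s t, 0 ≤ ρ s t) (hρsymm : ∀ s t, ρ s t = ρ t s)
    (γ : Diagram p k) :
    (∑ t ∈ Finset.univ.filter (fun t : Fin p → Fin n => Function.Injective t),
        ∏ uv ∈ Finset.univ.filter (fun uv : Fin p × Fin p => uv.1 < uv.2),
          ρ (t uv.1) (t uv.2) ^ γ.edges uv.1 uv.2)
      ≤ min
        (∏ uv ∈ Finset.univ.filter (fun uv : Fin p × Fin p => uv.1 < uv.2),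
          (∑ t : Fin n, (∑ s ∈ Finset.univ.filter (· ≠ t), ρ s t ^ k uv.1)
              ^ ((k uv.2 : ℝ) / (k uv.1 : ℝ))) ^ ((γ.edges uv.1 uv.2 : ℝ) / (k uv.2 : ℝ)))
        (∏ uv ∈ Finset.univ.filter (fun uv : Fin p × Fin p => uv.1 < uv.2),
          (∑ t : Fin n, (∑ s ∈ Finset.univ.filter (· ≠ t), ρ s t ^ k uv.2)
              ^ ((k uv.1 : ℝ) / (k uv.2 : ℝ))) ^ ((γ.edges uv.2 uv.1 : ℝ) / (k uv.1 : ℝ))) := by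
  refine le_min (sum_injective_prod_pow_le k hk ρ hρnn γ.edges γ.edges_self γ.edges_symm
    γ.sum_edges) ?_
  have h := sum_injective_prod_pow_le (fun u ↦ k u.rev) (fun u ↦ hk _) ρ hρnn
    (fun u v ↦ γ.edges u.rev v.rev) (fun u ↦ γ.edges_self _) (fun u v ↦ γ.edges_symm _ _)
    (fun u ↦ by
      rw [← γ.sum_edges u.rev]
      exact Equiv.sum_comp Fin.revPerm fun v ↦ γ.edges u.rev v)
  refine le_trans (le_of_eq ?_) (h.trans (le_of_eq ?_))
  · refine sum_nbij' (fun t u ↦ t u.rev) (fun t u ↦ t u.rev) ?_ ?_ (by simp) (by simp) ?_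
    · simp only [mem_filter, mem_univ, true_and]
      exact fun t ht ↦ ht.comp Fin.rev_injective
    · simp only [mem_filter, mem_univ, true_and]
      exact fun t ht ↦ ht.comp Fin.rev_injective
    · intro t _
      rw [← prod_filter_lt_rev]
      refine prod_congr rfl fun uv _ ↦ ?_
      rw [hρsymm, γ.edges_symm]
  · exact prod_filter_lt_rev fun uv ↦
      (∑ t : Fin n, (∑ s ∈ Finset.univ.filter (· ≠ t), ρ s t ^ k uv.2)
        ^ ((k uv.1 : ℝ) / (k uv.2 : ℝ))) ^ ((γ.edges uv.2 uv.1 : ℝ) / (k uv.1 : ℝ))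
end
end

section
/- Let p ≥ 2, m ≥ 1, 0 ≤ α ≤ p, and let k_1,…,k_p ≥ 1 be integers with k_u ≥ m for 1 ≤ u ≤ α. Let ρ : {1,…,n}² → [0,ε] be symmetric with 0 ≤ ε ≤ 1, set Q_n := max_{1≤t≤n} Σ_{s≠t} ρ(t,s)^m, and let γ be any diagram over the table T with rows of lengths k_1,…,k_p, with ℓ_{uv} edges between rows u and v. Then I_{n,T}(γ) := Σ' Π_{1≤u<v≤p} ρ(t_u,t_v)^{ℓ_{uv}} ≤ ε^{(k_1+…+k_p)/2 − mp} · n^{p−α} · (n Q_n)^{α/2}, where Σ' is the sum over p-tuples of pairwise distinct indices t_1,…,t_p in {1,…,n}. -/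
open MeasureTheory Finset Filter
open scoped BigOperators

noncomputable section

/-- Summing over all functions and resampling one coordinate. -/
theorem sum_sum_update {V X : Type*} [Fintype V] [DecidableEq V] [Fintype X]
    (u : V) (F : (V → X) → ℝ) :
    ∑ t : V → X, ∑ x : X, F (Function.update t u x) = Fintype.card X * ∑ t, F t := by
  classical
  let e : (V → X) × X ≃ (V → X) × X :=
    { toFun := fun q => (Function.update q.1 u q.2, q.1 u)
      invFun := fun q => (Function.update q.1 u q.2, q.1 u)
      left_inv := fun q => by simp
      right_inv := fun q => by simp }
  calc ∑ t : V → X, ∑ x : X, F (Function.update t u x)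
      = ∑ q : (V → X) × X, F (e q).1 := (Fintype.sum_prod_type fun q : (V → X) × X => F (e q).1).symm
    _ = ∑ q : (V → X) × X, F q.1 := e.sum_comp fun q => F q.1
    _ = Fintype.card X * ∑ t, F t := by
      rw [Fintype.sum_prod_type, Finset.mul_sum]
      simp

/-- A sum over vertex labellings of a product of kernels along the edges `u → f u`, `u ∈ A`, of a
functional graph without loops is bounded by one factor `c` per edge. -/
theorem sum_prod_functional_graph_le {V X : Type*} [Fintype V] [DecidableEq V] [Fintype X]
    [Nonempty X] (r : X → X → ℝ) (hr : ∀ x y, 0 ≤ r x y) {c : ℝ} (hc : 0 ≤ c)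
    (h₁ : ∀ y, ∑ x, r x y ≤ Fintype.card X * c)
    (h₂ : ∀ y z, ∑ x, r x y * r z x ≤ Fintype.card X * c ^ 2)
    (f : V → V) (hf : ∀ u, f u ≠ u) (A : Finset V) :
    ∑ t : V → X, ∏ u ∈ A, r (t u) (t (f u))
      ≤ (Fintype.card X : ℝ) ^ Fintype.card V * c ^ A.card := by
  induction A using Finset.strongInduction with
  | H A ih =>
    rcases A.eq_empty_or_nonempty with rfl | hA
    · simp
    obtain ⟨u, huA, hu⟩ : ∃ u ∈ A, #{w ∈ A | f w = u} ≤ 1 :=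
      exists_card_fiber_le_of_card_le_mul hA (by simp)
    set B := {w ∈ A | f w = u} with hB
    set C := {w ∈ A.erase u | f w ≠ u} with hC
    have hBe : {w ∈ A.erase u | f w = u} = B := by
      ext w
      simp only [hB, mem_filter, mem_erase]
      refine ⟨fun h => ⟨h.1.2, h.2⟩, fun h => ⟨⟨?_, h.1⟩, h.2⟩⟩
      rintro rfl
      exact hf _ h.2
    have hsplit (g : V → ℝ) : ∏ w ∈ A, g w = g u * (∏ w ∈ B, g w) * ∏ w ∈ C, g w := by
      rw [← mul_prod_erase A g huA, ← prod_filter_mul_prod_filter_not (A.erase u) (f · = u),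
        hBe, mul_assoc]
    have hcard : A.card = 1 + B.card + C.card := by
      rw [← card_erase_add_one huA, ← card_filter_add_card_filter_not (s := A.erase u) (f · = u),
        hBe]
      ring
    have hCA : C ⊂ A :=
      (filter_subset _ _).trans_ssubset (erase_ssubset huA)
    have hstep (t : V → X) :
        ∑ x, ∏ w ∈ A, r (Function.update t u x w) (Function.update t u x (f w))
          ≤ Fintype.card X * c ^ (1 + B.card) * ∏ w ∈ C, r (t w) (t (f w)) := by
      have hterm (x : X) :
          ∏ w ∈ A, r (Function.update t u x w) (Function.update t u x (f w))
            = r x (t (f u)) * (∏ w ∈ B, r (t w) x) * ∏ w ∈ C, r (t w) (t (f w)) := by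
        rw [hsplit]
        congr 1
        · congr 1
          · simp [hf u]
          · refine prod_congr rfl fun w hw => ?_
            have hfw : f w = u := (mem_filter.1 hw).2
            have hwu : w ≠ u := fun h => hf w (hfw.trans h.symm)
            simp [hfw, hwu]
        · refine prod_congr rfl fun w hw => ?_
          obtain ⟨hw, hfw⟩ := mem_filter.1 hw
          simp [hfw, ne_of_mem_erase hw]
      simp_rw [hterm, ← sum_mul]
      refine mul_le_mul_of_nonneg_right ?_ (prod_nonneg fun _ _ => hr _ _)
      rcases Nat.le_one_iff_eq_zero_or_eq_one.1 hu with h0 | h1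
      · rw [h0, card_eq_zero.1 h0]
        simpa using h₁ _
      · obtain ⟨w, hw⟩ := card_eq_one.1 h1
        rw [h1, hw]
        simpa using h₂ _ _
    have hX : (0 : ℝ) < Fintype.card X := by exact_mod_cast Fintype.card_pos
    refine le_of_mul_le_mul_left ?_ hX
    calc (Fintype.card X : ℝ) * ∑ t : V → X, ∏ w ∈ A, r (t w) (t (f w))
        = ∑ t : V → X, ∑ x, ∏ w ∈ A, r (Function.update t u x w) (Function.update t u x (f w)) :=
          (sum_sum_update u fun t => ∏ w ∈ A, r (t w) (t (f w))).symm
      _ ≤ ∑ t : V → X, Fintype.card X * c ^ (1 + B.card) * ∏ w ∈ C, r (t w) (t (f w)) :=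
          sum_le_sum fun t _ => hstep t
      _ = Fintype.card X * c ^ (1 + B.card) * ∑ t : V → X, ∏ w ∈ C, r (t w) (t (f w)) :=
          (mul_sum ..).symm
      _ ≤ Fintype.card X * c ^ (1 + B.card)
            * ((Fintype.card X : ℝ) ^ Fintype.card V * c ^ C.card) := by
          gcongr
          exact ih C hCA
      _ = Fintype.card X * ((Fintype.card X : ℝ) ^ Fintype.card V * c ^ A.card) := by
          rw [hcard, pow_add c (1 + B.card)]
          ring

/-- A product of `k ≥ m` numbers in `[0, e]` is at most `e ^ (k - m)` times the average of their
`m`-th powers. -/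
theorem prod_le_pow_mul_average {k m : ℕ} (hk : 1 ≤ k) (hmk : m ≤ k) {e : ℝ} (he : 0 ≤ e)
    (a : Fin k → ℝ) (ha : ∀ i, 0 ≤ a i) (hae : ∀ i, a i ≤ e) :
    ∏ i, a i ≤ e ^ (k - m) * ∑ i, (k : ℝ)⁻¹ * a i ^ m := by
  have hk0 : (k : ℝ) ≠ 0 := by positivity
  have hP : 0 ≤ ∏ i, a i := prod_nonneg fun i _ => ha i
  have hroot : ((∏ i, a i) ^ (k : ℝ)⁻¹) ^ k = ∏ i, a i := Real.rpow_inv_natCast_pow hP (by omega)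
  have hroot_le : (∏ i, a i) ^ (k : ℝ)⁻¹ ≤ e := by
    calc (∏ i, a i) ^ (k : ℝ)⁻¹ ≤ (e ^ k) ^ (k : ℝ)⁻¹ := by
          gcongr
          calc ∏ i, a i ≤ ∏ _i : Fin k, e := prod_le_prod (fun i _ => ha i) fun i _ => hae i
            _ = e ^ k := by simp
      _ = e := Real.pow_rpow_inv_natCast he (by omega)
  have hmean : ((∏ i, a i) ^ (k : ℝ)⁻¹) ^ m ≤ ∑ i, (k : ℝ)⁻¹ * a i ^ m := by
    calc ((∏ i, a i) ^ (k : ℝ)⁻¹) ^ m = ∏ i, (a i ^ m) ^ (k : ℝ)⁻¹ := by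
          rw [← Real.finsetProd_rpow _ _ fun i _ => ha i, ← prod_pow]
          refine prod_congr rfl fun i _ => ?_
          rw [← Real.rpow_mul_natCast (ha i), ← Real.rpow_natCast_mul (ha i), mul_comm]
      _ ≤ ∑ i, (k : ℝ)⁻¹ * a i ^ m :=
          Real.geom_mean_le_arith_mean_weighted _ _ _ (fun _ _ => by positivity)
            (by simp [hk0]) fun i _ => pow_nonneg (ha i) m
  calc ∏ i, a i
      = ((∏ i, a i) ^ (k : ℝ)⁻¹) ^ (k - m) * ((∏ i, a i) ^ (k : ℝ)⁻¹) ^ m := by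
        rw [← pow_add, Nat.sub_add_cancel hmk, hroot]
    _ ≤ e ^ (k - m) * ∑ i, (k : ℝ)⁻¹ * a i ^ m := by gcongr

namespace Diagram

variable {p : ℕ} {k : Fin p → ℕ} (γ : Diagram p k)

theorem edges_self_s3 (u : Fin p) : γ.edges u u = 0 := by
  rw [edges, card_eq_zero, filter_eq_empty_iff]
  rintro x - ⟨h₁, h₂⟩
  exact γ.offRow x (h₂.trans h₁.symm)

theorem edges_comm (u v : Fin p) : γ.edges u v = γ.edges v u := by
  refine card_bij' (fun x _ => γ.pair x) (fun x _ => γ.pair x) ?_ ?_ ?_ ?_ <;>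
    simp +contextual [γ.involutive]

/-- A product over the points of the table is a product over the edges, each taken twice. -/
theorem prod_points (g : Fin p → Fin p → ℝ) (hg : ∀ u v, g u v = g v u) :
    ∏ u, ∏ i, g u (γ.pair ⟨u, i⟩).1
      = ∏ uv ∈ univ.filter (fun uv : Fin p × Fin p => uv.1 < uv.2),
          (g uv.1 uv.2 ^ 2) ^ γ.edges uv.1 uv.2 := by
  have hfiber : ∏ u, ∏ i, g u (γ.pair ⟨u, i⟩).1
      = ∏ uv : Fin p × Fin p, g uv.1 uv.2 ^ γ.edges uv.1 uv.2 := by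
    rw [← Fintype.prod_sigma' fun u i => g u (γ.pair ⟨u, i⟩).1,
      ← prod_fiberwise univ (fun x : Σ w : Fin p, Fin (k w) => (x.1, (γ.pair x).1))]
    refine prod_congr rfl fun uv _ => ?_
    rw [edges, ← prod_const]
    refine prod_congr (by ext; simp [Prod.ext_iff]) fun x hx => ?_
    obtain ⟨h₁, h₂⟩ := (mem_filter.1 hx).2
    rw [← h₁, ← h₂]
  have hswap : ∏ uv ∈ univ.filter (fun uv : Fin p × Fin p => ¬ uv.1 < uv.2),
        g uv.1 uv.2 ^ γ.edges uv.1 uv.2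
      = ∏ uv ∈ univ.filter (fun uv : Fin p × Fin p => uv.1 < uv.2),
        g uv.1 uv.2 ^ γ.edges uv.1 uv.2 := by
    symm
    refine prod_bij_ne_one (fun uv _ _ => uv.swap) ?_ ?_ ?_ ?_
    · intro uv h _
      simpa using (mem_filter.1 h).2.le
    · intro _ _ _ _ _ _ h
      exact Prod.swap_injective h
    · rintro ⟨u, v⟩ h hne
      have hlt : v < u := by
        refine lt_of_le_of_ne (by simpa using h) ?_
        rintro rfl
        simp [γ.edges_self_s3] at hne
      refine ⟨(v, u), by simpa using hlt, ?_, rfl⟩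
      rwa [hg, γ.edges_comm]
    · intro uv _ _
      rw [Prod.fst_swap, Prod.snd_swap, hg, γ.edges_comm]
  rw [hfiber, ← prod_filter_mul_prod_filter_not univ (fun uv : Fin p × Fin p => uv.1 < uv.2),
    hswap, ← prod_mul_distrib]
  refine prod_congr rfl fun uv _ => ?_
  ring

/-- Averaging over the choice of one edge at every row: the product of the kernel `r` over the
points of the table is controlled by functional graphs. -/
theorem sum_injective_prod_le {X : Type*} [Fintype X] [DecidableEq X] [Nonempty X]
    (hk : ∀ u, 1 ≤ k u) (m : ℕ) (A : Finset (Fin p)) (hA : ∀ u ∈ A, m ≤ k u)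
    (a : X → X → ℝ) (ha : ∀ x y, 0 ≤ a x y) {e : ℝ} (he : 0 ≤ e) (hae : ∀ x y, a x y ≤ e)
    {c : ℝ} (hc : 0 ≤ c)
    (h₁ : ∀ y, (∑ x, if x = y then 0 else a x y ^ m) ≤ Fintype.card X * c)
    (h₂ : ∀ y z, (∑ x, (if x = y then 0 else a x y ^ m) * (if z = x then 0 else a z x ^ m))
      ≤ Fintype.card X * c ^ 2) :
    ∑ t ∈ univ.filter (fun t : Fin p → X => Function.Injective t),
        ∏ u, ∏ i, a (t u) (t (γ.pair ⟨u, i⟩).1)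
      ≤ e ^ (∑ u, (k u - if u ∈ A then m else 0))
          * ((Fintype.card X : ℝ) ^ p * c ^ A.card) := by
  set r : X → X → ℝ := fun x y => if x = y then 0 else a x y ^ m with hr
  have hr0 (x y : X) : 0 ≤ r x y := by
    simp only [hr]
    split_ifs
    exacts [le_rfl, pow_nonneg (ha _ _) _]
  set N := ∑ u, (k u - if u ∈ A then m else 0)
  let h (t : Fin p → X) (u v : Fin p) : ℝ := if u ∈ A then r (t u) (t v) else 1
  have hrow (t : Fin p → X) (ht : Function.Injective t) (u : Fin p) :
      ∏ i, a (t u) (t (γ.pair ⟨u, i⟩).1)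
        ≤ e ^ (k u - if u ∈ A then m else 0)
          * ∑ i, (k u : ℝ)⁻¹ * h t u (γ.pair ⟨u, i⟩).1 := by
    by_cases hu : u ∈ A
    · have hne (i : Fin (k u)) : t u ≠ t (γ.pair ⟨u, i⟩).1 :=
        fun H => γ.offRow ⟨u, i⟩ (ht H).symm
      simpa [h, hu, hr, hne] using prod_le_pow_mul_average (hk u) (hA u hu) he
        (fun i => a (t u) (t (γ.pair ⟨u, i⟩).1)) (fun _ => ha _ _) (fun _ => hae _ _)
    · simpa [h, hu] using prod_le_pow_mul_average (hk u) (Nat.zero_le _) he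
        (fun i => a (t u) (t (γ.pair ⟨u, i⟩).1)) (fun _ => ha _ _) (fun _ => hae _ _)
  have hpt (t : Fin p → X) (ht : Function.Injective t) :
      ∏ u, ∏ i, a (t u) (t (γ.pair ⟨u, i⟩).1)
        ≤ e ^ N * ∑ s : ∀ u, Fin (k u),
          (∏ u, (k u : ℝ)⁻¹) * ∏ u ∈ A, r (t u) (t (γ.pair ⟨u, s u⟩).1) := by
    calc ∏ u, ∏ i, a (t u) (t (γ.pair ⟨u, i⟩).1)
        ≤ ∏ u, e ^ (k u - if u ∈ A then m else 0)
            * ∑ i, (k u : ℝ)⁻¹ * h t u (γ.pair ⟨u, i⟩).1 :=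
          prod_le_prod (fun u _ => prod_nonneg fun _ _ => ha _ _) fun u _ => hrow t ht u
      _ = _ := by
          rw [prod_mul_distrib, prod_pow_eq_pow_sum, prod_univ_sum, Fintype.piFinset_univ]
          congr 1
          refine sum_congr rfl fun s _ => ?_
          rw [prod_mul_distrib]
          simp [h, prod_ite_mem]
  calc _ ≤ ∑ t ∈ univ.filter (fun t : Fin p → X => Function.Injective t),
        e ^ N * ∑ s : ∀ u, Fin (k u),
          (∏ u, (k u : ℝ)⁻¹) * ∏ u ∈ A, r (t u) (t (γ.pair ⟨u, s u⟩).1) :=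
        sum_le_sum fun t ht => hpt t (mem_filter.1 ht).2
    _ ≤ ∑ t : Fin p → X, e ^ N * ∑ s : ∀ u, Fin (k u),
          (∏ u, (k u : ℝ)⁻¹) * ∏ u ∈ A, r (t u) (t (γ.pair ⟨u, s u⟩).1) :=
        sum_le_sum_of_subset_of_nonneg (filter_subset _ _) fun t _ _ =>
          mul_nonneg (by positivity) (sum_nonneg fun s _ =>
            mul_nonneg (by positivity) (prod_nonneg fun _ _ => hr0 _ _))
    _ = e ^ N * ∑ s : ∀ u, Fin (k u), (∏ u, (k u : ℝ)⁻¹) * ∑ t : Fin p → X,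
          ∏ u ∈ A, r (t u) (t (γ.pair ⟨u, s u⟩).1) := by
        rw [← mul_sum, sum_comm]
        simp_rw [mul_sum]
    _ ≤ e ^ N * ∑ _s : ∀ u, Fin (k u), (∏ u, (k u : ℝ)⁻¹)
          * ((Fintype.card X : ℝ) ^ p * c ^ A.card) := by
        gcongr with s
        simpa using sum_prod_functional_graph_le r hr0 hc h₁ h₂
          (fun u => (γ.pair ⟨u, s u⟩).1) (fun u => γ.offRow _) A
    _ = e ^ N * ((Fintype.card X : ℝ) ^ p * c ^ A.card) := by
        have hone : (∏ u, (k u : ℝ)) * ∏ u, (k u : ℝ)⁻¹ = 1 := by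
          rw [← prod_mul_distrib]
          exact prod_eq_one fun u _ => mul_inv_cancel₀ (by have := hk u; positivity)
        simp only [sum_const, card_univ, Fintype.card_pi, Fintype.card_fin, nsmul_eq_mul,
          Nat.cast_prod]
        rw [← mul_assoc (∏ u, (k u : ℝ)), hone, one_mul]

end Diagram

/-- the bound (2.11) of Bardet–Surgailis for `I_{n,T}(γ)`. -/
theorem diagram_sum_bound
    (p n m α : ℕ) (hp : 2 ≤ p) (hm : 1 ≤ m) (hα : α ≤ p)
    (k : Fin p → ℕ) (hk : ∀ u, 1 ≤ k u) (hkm : ∀ u : Fin p, (u : ℕ) < α → m ≤ k u)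
    (ε : ℝ) (hε0 : 0 ≤ ε) (hε1 : ε ≤ 1)
    (ρ : Fin n → Fin n → ℝ) (hρnn : ∀ s t, 0 ≤ ρ s t) (hρε : ∀ s t, ρ s t ≤ ε)
    (hρsymm : ∀ s t, ρ s t = ρ t s) (γ : Diagram p k) :
    (∑ t ∈ Finset.univ.filter (fun t : Fin p → Fin n => Function.Injective t),
        ∏ uv ∈ Finset.univ.filter (fun uv : Fin p × Fin p => uv.1 < uv.2),
          ρ (t uv.1) (t uv.2) ^ γ.edges uv.1 uv.2)
      ≤ ε ^ ((∑ u, (k u : ℝ)) / 2 - (m : ℝ) * (p : ℝ))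
          * (n : ℝ) ^ ((p : ℝ) - (α : ℝ))
          * ((n : ℝ) * ⨆ t : Fin n, ∑ s ∈ Finset.univ.filter (· ≠ t), ρ t s ^ m)
              ^ ((α : ℝ) / 2) := by
  set Q : ℝ := ⨆ t : Fin n, ∑ s ∈ Finset.univ.filter (· ≠ t), ρ t s ^ m
  have hQ0 : 0 ≤ Q := Real.iSup_nonneg fun t => sum_nonneg fun s _ => pow_nonneg (hρnn _ _) _
  have hRHS : 0 ≤ ε ^ ((∑ u, (k u : ℝ)) / 2 - (m : ℝ) * (p : ℝ))
      * (n : ℝ) ^ ((p : ℝ) - (α : ℝ)) * ((n : ℝ) * Q) ^ ((α : ℝ) / 2) := by positivity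
  have hp0 : NeZero p := ⟨by omega⟩
  rcases Nat.eq_zero_or_pos n with rfl | hn
  · refine le_trans (le_of_eq (sum_eq_zero fun t _ => (t 0).elim0)) hRHS
  have : Nonempty (Fin n) := ⟨⟨0, hn⟩⟩
  have hn' : (0 : ℝ) < n := by exact_mod_cast hn
  have hsq (x y : Fin n) : √(ρ x y) ^ 2 = ρ x y := Real.sq_sqrt (hρnn x y)
  have hprod (t : Fin p → Fin n) :
      ∏ uv ∈ univ.filter (fun uv : Fin p × Fin p => uv.1 < uv.2),
          ρ (t uv.1) (t uv.2) ^ γ.edges uv.1 uv.2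
        = ∏ u, ∏ i, √(ρ (t u) (t (γ.pair ⟨u, i⟩).1)) := by
    rw [γ.prod_points (fun u v => √(ρ (t u) (t v))) fun u v => by rw [hρsymm]]
    simp_rw [hsq]
  simp_rw [hprod]
  rcases hε0.eq_or_lt with rfl | hε
  · refine le_trans (le_of_eq (sum_eq_zero fun t _ => ?_)) hRHS
    refine prod_eq_zero (mem_univ 0) (prod_eq_zero (mem_univ ⟨0, hk 0⟩) ?_)
    rw [Real.sqrt_eq_zero (hρnn _ _)]
    exact le_antisymm (hρε _ _) (hρnn _ _)
  have hsup (y : Fin n) : ∑ x ∈ univ.filter (· ≠ y), ρ y x ^ m ≤ Q :=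
    le_ciSup (f := fun t : Fin n => ∑ s ∈ univ.filter (· ≠ t), ρ t s ^ m)
      (Set.finite_range _).bddAbove y
  set r : Fin n → Fin n → ℝ := fun x y => if x = y then 0 else √(ρ x y) ^ m with hr
  have hrsymm (x y : Fin n) : r x y = r y x := by
    simp only [hr, hρsymm x y, eq_comm (a := x)]
  have hrsq (y : Fin n) : ∑ x, r x y ^ 2 ≤ Q := by
    refine le_trans (le_of_eq ?_) (hsup y)
    rw [sum_filter]
    refine sum_congr rfl fun x _ => ?_
    by_cases hxy : x = y
    · simp [hr, hxy]
    · simp only [hr, hxy, if_false, ne_eq, not_false_eq_true, if_true]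
      rw [← pow_mul, mul_comm, pow_mul, hsq, hρsymm]
  set c : ℝ := √(Q / n) with hc
  have hc0 : 0 ≤ c := Real.sqrt_nonneg _
  have hnc : n * c ^ 2 = Q := by
    rw [hc, Real.sq_sqrt (by positivity)]
    field_simp
  have h₁ (y : Fin n) : ∑ x, r x y ≤ Fintype.card (Fin n) * c := by
    rw [Fintype.card_fin]
    refine abs_le_of_sq_le_sq' ?_ (by positivity) |>.2
    calc (∑ x, r x y) ^ 2 ≤ n * ∑ x, r x y ^ 2 := by
          simpa using sq_sum_le_card_mul_sum_sq (s := univ) (f := fun x => r x y)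
      _ ≤ n * Q := by gcongr; exact hrsq y
      _ = (n * c) ^ 2 := by rw [← hnc]; ring
  have h₂ (y z : Fin n) : ∑ x, r x y * r z x ≤ Fintype.card (Fin n) * c ^ 2 := by
    rw [Fintype.card_fin, hnc]
    calc ∑ x, r x y * r z x ≤ ∑ x, (r x y ^ 2 + r x z ^ 2) / 2 := by
          refine sum_le_sum fun x _ => ?_
          rw [hrsymm z x]
          linarith [two_mul_le_add_sq (r x y) (r x z)]
      _ = (∑ x, r x y ^ 2 + ∑ x, r x z ^ 2) / 2 := by rw [← sum_div, sum_add_distrib]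
      _ ≤ Q := by linarith [hrsq y, hrsq z]
  set A : Finset (Fin p) := univ.filter fun u => (u : ℕ) < α with hA
  have hAcard : A.card = α := by simp [hA, Fin.card_filter_val_lt, hα]
  refine (γ.sum_injective_prod_le hk m A (fun u hu => hkm u (mem_filter.1 hu).2)
    (fun x y => √(ρ x y)) (fun _ _ => Real.sqrt_nonneg _) (Real.sqrt_nonneg ε)
    (fun _ _ => Real.sqrt_le_sqrt (hρε _ _)) hc0 h₁ h₂).trans ?_
  rw [mul_assoc, hAcard, Fintype.card_fin]
  refine mul_le_mul ?_ (le_of_eq ?_) (by positivity) (by positivity)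
  · rw [Real.sqrt_eq_rpow, ← Real.rpow_mul_natCast hε0]
    refine Real.rpow_le_rpow_of_exponent_ge hε hε1 ?_
    have hsum : ∑ u, (k u : ℝ) - m * p
        ≤ ((∑ u, (k u - if u ∈ A then m else 0) : ℕ) : ℝ) := by
      have hle : ∑ u, k u ≤ ∑ u, (k u - if u ∈ A then m else 0) + m * p := by
        calc ∑ u, k u ≤ ∑ u, ((k u - if u ∈ A then m else 0) + m) :=
              sum_le_sum fun u _ => by split_ifs <;> omega
          _ = _ := by simp [sum_add_distrib, mul_comm]
      rw [sub_le_iff_le_add]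
      exact_mod_cast hle
    have hmp : (0 : ℝ) ≤ m * p := by positivity
    linarith
  · rw [← Nat.cast_sub hα, Real.rpow_natCast, show (α : ℝ) / 2 = 2⁻¹ * (α : ℝ) by ring,
      Real.rpow_mul_natCast (by positivity), ← hnc,
      show (n : ℝ) * (n * c ^ 2) = (n * c) ^ 2 by ring,
      show (2 : ℝ)⁻¹ = ((2 : ℕ) : ℝ)⁻¹ by norm_num,
      Real.pow_rpow_inv_natCast (by positivity) two_ne_zero, mul_pow, ← mul_assoc, ← pow_add,
      Nat.sub_add_cancel hα]
end
end

section
/- Let (X_n(k))_{1≤k≤n, n∈N} be a triangular array of standardized Gaussian vectors in R^ν whose covariances r_n^{(p,q)}(j,k) := E[X_n^{(p)}(j)X_n^{(q)}(k)] satisfy, for some integer m ≥ 1 and all 1 ≤ p,q ≤ ν: sup_{n≥1} max_{1≤k≤n} Σ_{1≤j≤n} |r_n^{(p,q)}(j,k)|^m < ∞ and lim_{K→∞} sup_{n≥1} n^{−1} Σ_{1≤j,k≤n, |j−k|>K} |r_n^{(p,q)}(j,k)|^m = 0. Then for any p ≥ 3 and any multiindices k_1,…,k_p ∈ Z_+^ν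 with |k_u| ≥ m for all 1 ≤ u ≤ p, the sum of absolute joint cumulants Σ_{t_1,…,t_p=1}^n |cum( H_{k_1}(X_n(t_1)), …, H_{k_p}(X_n(t_p)) )| = o(n^{p/2}) as n → ∞. -/
open MeasureTheory ProbabilityTheory Finset Filter
open scoped BigOperators NNReal Topology

noncomputable section

def hermiteFun (k : ℕ) (x : ℝ) : ℝ := Polynomial.aeval x (Polynomial.hermite k)

def hermiteProd {ν : ℕ} (k : Fin ν → ℕ) (x : Fin ν → ℝ) : ℝ := ∏ i, hermiteFun (k i) (x i)

def IsJointGaussian {Ω : Type*} [MeasurableSpace Ω] (P : Measure Ω) {ι : Type*}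
    (X : ι → Ω → ℝ) : Prop :=
  ∀ (s : Finset ι) (c : ι → ℝ), ∃ (μ : ℝ) (v : ℝ≥0),
    P.map (fun ω => ∑ i ∈ s, c i * X i ω) = gaussianReal μ v

/-- The joint cumulant `cum(ξ_1,…,ξ_p)`, defined through the
moments-to-cumulants Möbius formula
`cum(ξ_1,…,ξ_p) = Σ_π (-1)^{|π|-1}(|π|-1)! Π_{B∈π} E Π_{i∈B} ξ_i`,
the sum being over all partitions `π` of `{1,…,p}`. -/
def jointCumulant {Ω : Type*} [MeasurableSpace Ω] (P : Measure Ω) {p : ℕ}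
    (ξ : Fin p → Ω → ℝ) : ℝ :=
  ∑ π ∈ (Finset.univ : Finset (Finset (Finset (Fin p)))).filter
      (fun π => π.sup id = Finset.univ ∧ (∅ : Finset (Fin p)) ∉ π ∧
        ∀ B ∈ π, ∀ B' ∈ π, B ≠ B' → B ∩ B' = ∅),
    (-1 : ℝ) ^ (π.card - 1) * (Nat.factorial (π.card - 1) : ℝ) *
      ∏ B ∈ π, ∫ ω, ∏ i ∈ B, ξ i ω ∂P

/-- Gaussian integration by parts for monomials. -/
lemma integral_pow_mul_self_gaussianReal (j : ℕ) :
    ∫ x, x ^ j * x ∂(gaussianReal 0 1) = j * ∫ x, x ^ (j - 1) ∂(gaussianReal 0 1) := by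
  have hpow : ∀ i : ℕ, Integrable (fun x : ℝ => x ^ i * gaussianPDFReal 0 1 x) := by
    intro i
    have h : Integrable (fun x : ℝ => x ^ i * Real.exp (-(1 / 2) * x ^ 2)) := by
      have := integrable_rpow_mul_exp_neg_mul_sq (b := 1 / 2) (by norm_num) (s := i)
        (by have : (0 : ℝ) ≤ i := by positivity
            linarith)
      simpa using this
    have h2 := h.const_mul ((√(2 * Real.pi * (1 : ℝ≥0)))⁻¹)
    refine h2.congr (ae_of_all _ fun x => ?_)
    simp only [gaussianPDFReal]
    rw [show -(x - 0) ^ 2 / (2 * ((1 : ℝ≥0) : ℝ)) = -(1 / 2) * x ^ 2 by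
      push_cast; ring]
    ring
  have hder : ∀ x : ℝ, HasDerivAt (gaussianPDFReal 0 1) (-(x * gaussianPDFReal 0 1 x)) x := by
    intro x
    have h1 : HasDerivAt (fun y : ℝ => -(y - 0) ^ 2 / (2 * ((1 : ℝ≥0) : ℝ))) (-x) x := by
      have := (((hasDerivAt_id x).sub_const 0).pow 2).neg.div_const (2 * ((1 : ℝ≥0) : ℝ))
      convert! this using 1
      simp
      ring
    have h2 := (h1.exp).const_mul ((√(2 * Real.pi * (1 : ℝ≥0)))⁻¹)
    convert! h2 using 1
    simp only [gaussianPDFReal]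
    ring
  have key := integral_mul_deriv_eq_deriv_mul_of_integrable
    (u := fun x : ℝ => x ^ j) (u' := fun x : ℝ => j * x ^ (j - 1))
    (v := gaussianPDFReal 0 1) (v' := fun x => -(x * gaussianPDFReal 0 1 x))
    (fun x _ => hasDerivAt_pow j x) (fun x _ => hder x)
    ((hpow (j + 1)).neg.congr (ae_of_all _ fun x => by simp [pow_succ]; ring))
    (((hpow (j - 1)).const_mul (j : ℝ)).congr (ae_of_all _ fun x => by simp; ring))
    (hpow j)
  rw [integral_gaussianReal_eq_integral_smul one_ne_zero,
    integral_gaussianReal_eq_integral_smul one_ne_zero, ← integral_const_mul]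
  have e1 : ∫ x : ℝ, gaussianPDFReal 0 1 x • (x ^ j * x) =
      -∫ x : ℝ, x ^ j * (-(x * gaussianPDFReal 0 1 x)) := by
    rw [← integral_neg]
    exact integral_congr_ae (ae_of_all _ fun x => by simp; ring)
  rw [e1, key, neg_neg]
  exact integral_congr_ae (ae_of_all _ fun x => by simp; ring)

/-- Finiteness of all moments is preserved by multiplication. -/
lemma memLp_mul_of_forall {Ω : Type*} [MeasurableSpace Ω] {P : Measure Ω} {f g : Ω → ℝ}
    (hf : ∀ q : ℝ≥0, MemLp f q P) (hg : ∀ q : ℝ≥0, MemLp g q P) (q : ℝ≥0) :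
    MemLp (fun ω => f ω * g ω) q P := by
  have : ENNReal.HolderTriple ((2 * q : ℝ≥0) : ENNReal) ((2 * q : ℝ≥0) : ENNReal) q := by
    constructor
    push_cast
    rw [ENNReal.mul_inv (by simp) (by simp), ← add_mul, ENNReal.inv_two_add_inv_two, one_mul]
  exact (hg (2 * q)).mul (hf (2 * q))

lemma memLp_aeval_mvPolynomial {Ω A : Type*} [MeasurableSpace Ω] {P : Measure Ω}
    [IsProbabilityMeasure P] {Y : A → Ω → ℝ} (hY : ∀ a, ∀ q : ℝ≥0, MemLp (Y a) q P)
    (f : MvPolynomial A ℝ) (q : ℝ≥0) :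
    MemLp (fun ω => MvPolynomial.aeval (fun a => Y a ω) f) q P := by
  induction f using MvPolynomial.induction_on generalizing q with
  | C c => simpa using memLp_const c
  | add f g hf hg =>
    simp only [map_add]
    exact (hf q).add (hg q)
  | mul_X f a hf =>
    simpa using memLp_mul_of_forall hf (hY a) q

lemma integrable_aeval_mvPolynomial {Ω A : Type*} [MeasurableSpace Ω] {P : Measure Ω}
    [IsProbabilityMeasure P] {Y : A → Ω → ℝ} (hY : ∀ a, ∀ q : ℝ≥0, MemLp (Y a) q P)
    (f : MvPolynomial A ℝ) :
    Integrable (fun ω => MvPolynomial.aeval (fun a => Y a ω) f) P :=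
  memLp_one_iff_integrable.1 (by simpa using memLp_aeval_mvPolynomial hY f 1)

/-- Stein's identity in the direction of a standard Gaussian variable independent of the others. -/
lemma integral_mul_aeval_eq_pderiv_none {Ω A : Type*} [Fintype A] [MeasurableSpace Ω]
    {P : Measure Ω} [IsProbabilityMeasure P] {U : Ω → ℝ} {Z : A → Ω → ℝ}
    (hU : ∀ q : ℝ≥0, MemLp U q P) (hZ : ∀ a, ∀ q : ℝ≥0, MemLp (Z a) q P)
    (hlaw : P.map U = gaussianReal 0 1) (hind : IndepFun U (fun ω a => Z a ω) P)
    (g : MvPolynomial (Option A) ℝ) :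
    ∫ ω, U ω * MvPolynomial.aeval (fun o : Option A => o.elim (U ω) (fun a => Z a ω)) g ∂P =
      ∫ ω, MvPolynomial.aeval (fun o : Option A => o.elim (U ω) (fun a => Z a ω))
        (MvPolynomial.pderiv none g) ∂P := by
  classical
  have hUm : AEMeasurable U P := (hU 0).1.aemeasurable
  set W : Option A → Ω → ℝ := fun o ω => o.elim (U ω) (fun a => Z a ω) with hW
  have hWq : ∀ o, ∀ q : ℝ≥0, MemLp (W o) q P := by
    rintro (_ | a) q
    · exact hU q
    · exact hZ a q
  have hint : ∀ f : MvPolynomial (Option A) ℝ,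
      Integrable (fun ω => MvPolynomial.aeval (fun o => W o ω) f) P :=
    integrable_aeval_mvPolynomial hWq
  have hint' : ∀ f : MvPolynomial (Option A) ℝ,
      Integrable (fun ω => U ω * MvPolynomial.aeval (fun o => W o ω) f) P := by
    intro f
    refine (hint (MvPolynomial.X none * f)).congr (ae_of_all _ fun ω => ?_)
    simp [hW]
  change ∫ ω, U ω * MvPolynomial.aeval (fun o => W o ω) g ∂P =
      ∫ ω, MvPolynomial.aeval (fun o => W o ω) (MvPolynomial.pderiv none g) ∂P
  induction g using MvPolynomial.induction_on' with
  | monomial s c =>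
    have hev : ∀ (s : Option A →₀ ℕ) (c : ℝ) (ω : Ω),
        MvPolynomial.aeval (fun o => W o ω) (MvPolynomial.monomial s c) =
          c * ((U ω) ^ (s none) * ∏ a, Z a ω ^ (s (some a))) := by
      intro s c ω
      rw [MvPolynomial.aeval_monomial, Finsupp.prod_fintype _ _ (by simp), Fintype.prod_option]
      simp [hW]
    have hfac : ∀ j : ℕ, ∫ ω, (U ω) ^ j * ∏ a, Z a ω ^ (s (some a)) ∂P =
        (∫ x, x ^ j ∂(gaussianReal 0 1)) * ∫ ω, ∏ a, Z a ω ^ (s (some a)) ∂P := by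
      intro j
      have h1 : IndepFun (fun ω => (U ω) ^ j) (fun ω => ∏ a, Z a ω ^ (s (some a))) P :=
        hind.comp (φ := fun x => x ^ j) (ψ := fun z : A → ℝ => ∏ a, z a ^ (s (some a)))
          (by fun_prop) (by fun_prop)
      have h2 := h1.integral_fun_mul_eq_mul_integral (by fun_prop) ?_
      · rw [h2, ← hlaw, integral_map hUm (by fun_prop)]
      · exact Finset.aestronglyMeasurable_fun_prod _ fun a _ => ((hZ a 0).1.pow _)
    rw [MvPolynomial.pderiv_monomial]
    simp only [hev]
    have e1 : ∀ ω, U ω * (c * (U ω ^ s none * ∏ a, Z a ω ^ s (some a))) =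
        c * (U ω ^ (s none + 1) * ∏ a, Z a ω ^ s (some a)) := fun ω => by ring
    simp only [e1, integral_const_mul]
    have e2 : ∀ a, (s - Finsupp.single none 1 : Option A →₀ ℕ) (some a) = s (some a) :=
      fun a => by simp
    have e3 : (s - Finsupp.single none 1 : Option A →₀ ℕ) none = s none - 1 := by simp
    simp only [e2, e3]
    rw [hfac, hfac]
    have := integral_pow_mul_self_gaussianReal (s none)
    simp only [← pow_succ] at this
    rw [this]
    ring
  | add f g hf hg =>
    simp only [map_add, mul_add]
    rw [integral_add (hint' f) (hint' g), integral_add (hint _) (hint _), hf, hg]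

/-- Stein's identity for polynomials in a centered Gaussian vector. -/
lemma integral_mul_aeval_eq_sum_pderiv {Ω A : Type*} [Fintype A] [DecidableEq A]
    [MeasurableSpace Ω] {P : Measure Ω} [IsProbabilityMeasure P] {Y : A → Ω → ℝ}
    (hG : HasGaussianLaw (fun ω a => Y a ω) P) (hc : ∀ a, ∫ ω, Y a ω ∂P = 0) (a : A)
    (hv : ∫ ω, Y a ω * Y a ω ∂P = 1) (f : MvPolynomial A ℝ) :
    ∫ ω, Y a ω * MvPolynomial.aeval (fun b => Y b ω) f ∂P =
      ∑ b, (∫ ω, Y a ω * Y b ω ∂P) *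
        ∫ ω, MvPolynomial.aeval (fun b => Y b ω) (MvPolynomial.pderiv b f) ∂P := by
  set S : A → ℝ := fun b => ∫ ω, Y a ω * Y b ω ∂P with hS
  set Z : A → Ω → ℝ := fun b ω => Y b ω - S b * Y a ω with hZ
  have hYq : ∀ b, ∀ q : ℝ≥0, MemLp (Y b) q P := fun b q => (hG.eval b).memLp (by simp)
  have hZq : ∀ b, ∀ q : ℝ≥0, MemLp (Z b) q P := fun b q =>
    (hYq b q).sub ((hYq a q).const_mul (S b))
  have hY2 : ∀ b, MemLp (Y b) 2 P := fun b => hYq b 2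
  have hcov : ∀ b c, cov[Y b, Y c; P] = ∫ ω, Y b ω * Y c ω ∂P := by
    intro b c
    rw [covariance_eq_sub (hY2 b) (hY2 c), hc b, zero_mul, sub_zero]
    rfl
  have hind : IndepFun (Y a) (fun ω b => Z b ω) P := by
    have hlin : HasGaussianLaw (fun ω => (fun _ : Unit => Y a ω, fun b => Z b ω)) P := by
      have := hG.map_fun (ContinuousLinearMap.prod
        (ContinuousLinearMap.pi fun _ : Unit => ContinuousLinearMap.proj (R := ℝ) a)
        (ContinuousLinearMap.pi fun b => ContinuousLinearMap.proj (R := ℝ) b -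
          S b • ContinuousLinearMap.proj (R := ℝ) (φ := fun _ : A => ℝ) a))
      exact this
    have h := hlin.indepFun_of_covariance_eval (X := fun _ : Unit => Y a) (Y := Z) (by
      intro _ b
      have : Z b = Y b - fun ω => S b * Y a ω := rfl
      rw [this, covariance_sub_right (hY2 a) (hY2 b) ((hY2 a).const_mul _),
        covariance_const_mul_right, hcov, hcov, hv, mul_one]
      simp [hS])
    exact h.comp (φ := fun x : Unit → ℝ => x ()) (ψ := id) (by fun_prop) measurable_id
  have hlaw : P.map (Y a) = gaussianReal 0 1 := by
    rw [(hG.eval a).map_eq_gaussianReal, hc a]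
    congr 1
    rw [← covariance_self (hY2 a).1.aemeasurable, hcov, hv]
    simp
  set Ψ : MvPolynomial A ℝ →ₐ[ℝ] MvPolynomial (Option A) ℝ := MvPolynomial.aeval
    (fun b => MvPolynomial.X (some b) + MvPolynomial.C (S b) * MvPolynomial.X none) with hΨ
  have hev : ∀ (g : MvPolynomial A ℝ) ω,
      MvPolynomial.aeval (fun o : Option A => o.elim (Y a ω) (fun b => Z b ω)) (Ψ g) =
        MvPolynomial.aeval (fun b => Y b ω) g := by
    intro g ω
    induction g using MvPolynomial.induction_on with
    | C c => simp
    | add f g hf hg => simp only [map_add, hf, hg]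
    | mul_X f b hf =>
      rw [map_mul, map_mul, map_mul, hf]
      congr 1
      simp [hΨ, hZ]
  have hder : ∀ g : MvPolynomial A ℝ, MvPolynomial.pderiv none (Ψ g) =
      ∑ b, MvPolynomial.C (S b) * Ψ (MvPolynomial.pderiv b g) := by
    intro g
    induction g using MvPolynomial.induction_on with
    | C c => simp
    | add f g hf hg => simp only [map_add, hf, hg, mul_add, Finset.sum_add_distrib]
    | mul_X f b hf =>
      have hX : Ψ (MvPolynomial.X b) =
          MvPolynomial.X (some b) + MvPolynomial.C (S b) * MvPolynomial.X none := by simp [hΨ]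
      simp only [map_mul, Derivation.leibniz, hf, map_add, smul_eq_mul, hX,
        MvPolynomial.pderiv_X, MvPolynomial.pderiv_C]
      simp only [mul_add, Finset.sum_add_distrib, Finset.mul_sum]
      congr 1
      · rw [Finset.sum_eq_single b]
        · simp
          ring
        · intro c _ hcb
          simp [hcb.symm]
        · simp
      · refine Finset.sum_congr rfl fun c _ => ?_
        ring
  have key := integral_mul_aeval_eq_pderiv_none (hYq a) hZq hlaw hind (Ψ f)
  rw [hder] at key
  simp only [hev, map_sum, map_mul] at key
  rw [key, integral_finsetSum]
  · refine Finset.sum_congr rfl fun b _ => ?_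
    simp only [MvPolynomial.algHom_C, Algebra.algebraMap_self_apply, integral_const_mul, hS]
  · intro b _
    simpa using (integrable_aeval_mvPolynomial hYq (MvPolynomial.pderiv b f)).const_mul (S b)

lemma derivative_hermite (n : ℕ) :
    Polynomial.derivative (Polynomial.hermite n) = n * Polynomial.hermite (n - 1) := by
  induction n with
  | zero => simp
  | succ n ih =>
    rw [Polynomial.hermite_succ, Polynomial.derivative_sub, Polynomial.derivative_mul, ih]
    rcases n with _ | n
    · simp
    · simp only [Nat.add_sub_cancel, Polynomial.derivative_mul, Polynomial.derivative_X,
        Polynomial.derivative_natCast, Polynomial.hermite_succ n]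
      push_cast
      ring

/-- The product of Hermite polynomials in independent indeterminates. -/
def hermiteMv {A : Type*} [Fintype A] (k : A → ℕ) : MvPolynomial A ℝ :=
  ∏ b, Polynomial.aeval (MvPolynomial.X b)
    ((Polynomial.hermite (k b)).map (algebraMap ℤ ℝ))

lemma aeval_hermiteMv {A : Type*} [Fintype A] (k : A → ℕ) (y : A → ℝ) :
    MvPolynomial.aeval y (hermiteMv k) = ∏ b, hermiteFun (k b) (y b) := by
  simp only [hermiteMv, map_prod, hermiteFun]
  refine Finset.prod_congr rfl fun b _ => ?_
  rw [← Polynomial.aeval_algHom_apply, MvPolynomial.aeval_X, Polynomial.aeval_map_algebraMap]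

lemma pderiv_hermiteMv {A : Type*} [Fintype A] [DecidableEq A] (k : A → ℕ) (b : A) :
    MvPolynomial.pderiv b (hermiteMv k) =
      MvPolynomial.C (k b : ℝ) * hermiteMv (k - Pi.single b 1) := by
  have hsub : ∀ c ∈ Finset.univ.erase b, (k - Pi.single b 1 : A → ℕ) c = k c := by
    intro c hc
    simp [(Finset.mem_erase.1 hc).1]
  have hzero : MvPolynomial.pderiv b (∏ c ∈ Finset.univ.erase b,
      Polynomial.aeval (MvPolynomial.X c : MvPolynomial A ℝ)
        ((Polynomial.hermite (k c)).map (algebraMap ℤ ℝ))) = 0 := by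
    refine Finset.prod_induction _ (fun f => MvPolynomial.pderiv b f = 0) ?_ (by simp) ?_
    · intro f g hf hg
      simp [Derivation.leibniz, hf, hg]
    · intro c hc
      rw [Derivation.map_aeval, MvPolynomial.pderiv_X_of_ne (Finset.mem_erase.1 hc).1, smul_zero]
  rw [hermiteMv, hermiteMv, ← Finset.mul_prod_erase _ _ (Finset.mem_univ b),
    ← Finset.mul_prod_erase _ _ (Finset.mem_univ b), Derivation.leibniz, hzero, smul_zero,
    zero_add, Derivation.map_aeval, MvPolynomial.pderiv_X_self, Polynomial.derivative_map,
    derivative_hermite]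
  have : ∏ c ∈ Finset.univ.erase b, Polynomial.aeval (MvPolynomial.X c : MvPolynomial A ℝ)
      ((Polynomial.hermite ((k - Pi.single b 1 : A → ℕ) c)).map (algebraMap ℤ ℝ)) =
      ∏ c ∈ Finset.univ.erase b, Polynomial.aeval (MvPolynomial.X c : MvPolynomial A ℝ)
      ((Polynomial.hermite (k c)).map (algebraMap ℤ ℝ)) :=
    Finset.prod_congr rfl fun c hc => by rw [hsub c hc]
  rw [this]
  simp only [smul_eq_mul, Pi.sub_apply, Pi.single_eq_same, Polynomial.map_mul,
    Polynomial.map_natCast, map_mul, map_natCast, mul_one]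
  ring

lemma hermiteMv_add_single {A : Type*} [Fintype A] [DecidableEq A] (k : A → ℕ) (a : A) :
    hermiteMv (k + Pi.single a 1) = MvPolynomial.X a * hermiteMv k -
      MvPolynomial.C (k a : ℝ) * hermiteMv (k - Pi.single a 1) := by
  have h1 : ∀ c ∈ Finset.univ.erase a, (k + Pi.single a 1 : A → ℕ) c = k c := by
    intro c hc
    simp [(Finset.mem_erase.1 hc).1]
  have h2 : ∀ c ∈ Finset.univ.erase a, (k - Pi.single a 1 : A → ℕ) c = k c := by
    intro c hc
    simp [(Finset.mem_erase.1 hc).1]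
  simp only [hermiteMv, ← Finset.mul_prod_erase _ _ (Finset.mem_univ a)]
  have h3 : ∀ k' : A → ℕ, (∀ c ∈ Finset.univ.erase a, k' c = k c) →
      ∏ c ∈ Finset.univ.erase a, Polynomial.aeval (MvPolynomial.X c : MvPolynomial A ℝ)
        ((Polynomial.hermite (k' c)).map (algebraMap ℤ ℝ)) =
      ∏ c ∈ Finset.univ.erase a, Polynomial.aeval (MvPolynomial.X c : MvPolynomial A ℝ)
        ((Polynomial.hermite (k c)).map (algebraMap ℤ ℝ)) :=
    fun k' h => Finset.prod_congr rfl fun c hc => by rw [h c hc]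
  rw [h3 _ h1, h3 _ h2]
  simp only [Pi.add_apply, Pi.sub_apply, Pi.single_eq_same, Polynomial.hermite_succ,
    derivative_hermite, Polynomial.map_sub, Polynomial.map_mul, Polynomial.map_X,
    Polynomial.map_natCast, map_sub, map_mul, map_natCast, Polynomial.aeval_X]
  ring

/-- The recursion for expectations of products of Hermite polynomials of a standardized
Gaussian family. -/
theorem integral_hermite_add_single {Ω A : Type*} [Fintype A] [DecidableEq A]
    [MeasurableSpace Ω] {P : Measure Ω} [IsProbabilityMeasure P] {Y : A → Ω → ℝ}
    (hG : HasGaussianLaw (fun ω a => Y a ω) P) (hc : ∀ a, ∫ ω, Y a ω ∂P = 0)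
    (hv : ∀ a, ∫ ω, Y a ω * Y a ω ∂P = 1) (k : A → ℕ) (a : A) :
    ∫ ω, ∏ b, hermiteFun ((k + Pi.single a 1 : A → ℕ) b) (Y b ω) ∂P =
      ∑ b ∈ Finset.univ.erase a, (∫ ω, Y a ω * Y b ω ∂P) * k b *
        ∫ ω, ∏ c, hermiteFun ((k - Pi.single b 1 : A → ℕ) c) (Y c ω) ∂P := by
  have hint := integrable_aeval_mvPolynomial (P := P) (Y := Y)
    (fun b q => (hG.eval b).memLp (by simp))
  have key := integral_mul_aeval_eq_sum_pderiv hG hc a (hv a) (hermiteMv k)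
  simp only [← aeval_hermiteMv, hermiteMv_add_single]
  simp only [pderiv_hermiteMv, map_mul, MvPolynomial.algHom_C, Algebra.algebraMap_self_apply,
    integral_const_mul] at key
  simp only [map_sub, map_mul, MvPolynomial.aeval_X, MvPolynomial.algHom_C,
    Algebra.algebraMap_self_apply]
  rw [integral_sub, key, integral_const_mul, ← Finset.add_sum_erase _ _ (Finset.mem_univ a),
    hv a]
  · simp only [mul_assoc]
    ring
  · exact (hint (MvPolynomial.X a * hermiteMv k)).congr (ae_of_all _ fun ω => by simp)
  · simpa using (hint (hermiteMv (k - Pi.single a 1))).const_mul (k a : ℝ)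

/-- The recursion satisfied by Gaussian expectations of Hermite products, when the pairing
`S` only connects indeterminates lying in different rows. -/
def HermiteRec {A ι : Type*} [Fintype A] [DecidableEq A] [DecidableEq ι] (r : A → ι)
    (S : A → A → ℝ) (F : (A → ℕ) → ℝ) : Prop :=
  F 0 = 1 ∧ ∀ (k : A → ℕ) (a : A), F (k + Pi.single a 1) =
    ∑ b with r a ≠ r b, S a b * k b * F (k - Pi.single b 1)

/-- The diagram formula: solutions of the Hermite recursion are polynomials in the pairings
whose monomials are the diagrams with prescribed degrees and no edge inside a row. -/
theorem exists_diagram_polynomial {A ι : Type*} [Fintype A] [DecidableEq A] [DecidableEq ι]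
    (r : A → ι) (k : A → ℕ) :
    ∃ Φ : MvPolynomial (A × A) ℝ,
      (∀ S F, HermiteRec r S F → F k = MvPolynomial.eval (fun e => S e.1 e.2) Φ) ∧
      ∀ l, Φ.coeff l ≠ 0 → (∀ e, l e ≠ 0 → r e.1 ≠ r e.2) ∧
        ∀ c, ∑ d, (l (c, d) + l (d, c)) = k c := by
  obtain ⟨N, hN⟩ : ∃ N, ∑ a, k a = N := ⟨_, rfl⟩
  induction N using Nat.strong_induction_on generalizing k with
  | _ N ih =>
  by_cases hk : k = 0
  · subst hk
    refine ⟨1, fun S F h => by simpa using h.1, fun l hl => ?_⟩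
    rw [MvPolynomial.coeff_one] at hl
    have : l = 0 := by
      by_contra h
      exact hl (if_neg (Ne.symm h))
    subst this
    simp
  · obtain ⟨a, ha⟩ : ∃ a, k a ≠ 0 := by
      by_contra! h
      exact hk (funext h)
    set k' : A → ℕ := k - Pi.single a 1 with hk'
    have hkk : k = k' + Pi.single a 1 := by
      ext c
      by_cases hc : c = a
      · subst hc
        simp [hk']
        omega
      · simp [hk', hc]
    have hsum : ∑ c, k' c < N := by
      rw [← hN]
      refine Finset.sum_lt_sum (fun c _ => by simp [hk']) ⟨a, Finset.mem_univ a, ?_⟩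
      simp [hk']
      omega
    have hb : ∀ b : A, ∑ c, (k' - Pi.single b 1 : A → ℕ) c < N := fun b =>
      lt_of_le_of_lt (Finset.sum_le_sum fun c _ => by simp) hsum
    choose Φ hΦ1 hΦ2 using fun b => ih _ (hb b) (k' - Pi.single b 1) rfl
    refine ⟨∑ b with r a ≠ r b,
      MvPolynomial.monomial (Finsupp.single (a, b) 1) (k' b : ℝ) * Φ b, ?_, ?_⟩
    · intro S F h
      rw [hkk, h.2, map_sum]
      refine Finset.sum_congr rfl fun b _ => ?_
      rw [map_mul, MvPolynomial.eval_monomial, ← hΦ1 b S F h]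
      simp
      exact Or.inl (by ring)
    · intro l hl
      rw [MvPolynomial.coeff_sum] at hl
      obtain ⟨b, hbm, hbl⟩ := Finset.exists_ne_zero_of_sum_ne_zero hl
      rw [MvPolynomial.coeff_monomial_mul'] at hbl
      have hab : r a ≠ r b := (Finset.mem_filter.1 hbm).2
      have hab' : a ≠ b := fun h => hab (by rw [h])
      split_ifs at hbl with hle
      · obtain ⟨hk0, hc0⟩ := mul_ne_zero_iff.1 hbl
        have hk0' : k' b ≠ 0 := by exact_mod_cast hk0
        obtain ⟨h1, h2⟩ := hΦ2 b _ hc0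
        set l' := l - Finsupp.single (a, b) 1 with hl'
        have hll : l = l' + Finsupp.single (a, b) 1 := (tsub_add_cancel_of_le hle).symm
        refine ⟨fun e he => ?_, fun c => ?_⟩
        · by_cases hee : e = (a, b)
          · rw [hee]
            exact hab
          · refine h1 e ?_
            rw [hll] at he
            simpa [Finsupp.single_apply, Ne.symm hee] using he
        · have hc := h2 c
          have e1 : ∑ d, (Finsupp.single (a, b) 1 : A × A →₀ ℕ) (c, d) =
              (Pi.single a 1 : A → ℕ) c := by
            simp only [Finsupp.single_apply, Prod.mk.injEq, Pi.single_apply, ite_and]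
            by_cases h : a = c
            · simp [h]
            · simp [h, Ne.symm h]
          have e2 : ∑ d, (Finsupp.single (a, b) 1 : A × A →₀ ℕ) (d, c) =
              (Pi.single b 1 : A → ℕ) c := by
            simp only [Finsupp.single_apply, Prod.mk.injEq, Pi.single_apply, ite_and]
            by_cases h : b = c
            · simp [h]
            · simp [h, Ne.symm h]
          rw [hll, hkk]
          simp only [Finsupp.add_apply, Pi.add_apply, Finset.sum_add_distrib] at hc ⊢
          rw [e1, e2]
          have e3 : (k' - Pi.single b 1 : A → ℕ) c + (Pi.single b 1 : A → ℕ) c = k' c := by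
            by_cases h : c = b
            · subst h
              simp
              omega
            · simp [h]
          omega
      · exact absurd rfl hbl

/-- The family of all partitions of `Fin p`. -/
def partitions (p : ℕ) : Finset (Finset (Finset (Fin p))) :=
  (Finset.univ : Finset (Finset (Finset (Fin p)))).filter
    (fun π => π.sup id = Finset.univ ∧ (∅ : Finset (Fin p)) ∉ π ∧
      ∀ B ∈ π, ∀ B' ∈ π, B ≠ B' → B ∩ B' = ∅)

lemma mem_partitions {p : ℕ} {π : Finset (Finset (Fin p))} :
    π ∈ partitions p ↔ (∀ x, ∃ B ∈ π, x ∈ B) ∧ (∀ B ∈ π, B.Nonempty) ∧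
      ∀ B ∈ π, ∀ B' ∈ π, ∀ x ∈ B, x ∈ B' → B = B' := by
  simp only [partitions, Finset.mem_filter, Finset.mem_univ, true_and]
  refine and_congr ?_ (and_congr ?_ ?_)
  · simp [Finset.ext_iff]
  · constructor
    · intro h B hB
      rw [Finset.nonempty_iff_ne_empty]
      rintro rfl
      exact h hB
    · intro h h0
      simpa using h _ h0
  · refine forall₂_congr fun B _ => forall₂_congr fun B' _ => ?_
    constructor
    · intro h x hx hx'
      by_contra hne
      have := h hne
      have hx2 : x ∈ B ∩ B' := Finset.mem_inter.2 ⟨hx, hx'⟩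
      simp [this] at hx2
    · intro h hne
      by_contra h0
      obtain ⟨x, hx⟩ := Finset.nonempty_iff_ne_empty.2 h0
      exact hne (h x (Finset.mem_inter.1 hx).1 (Finset.mem_inter.1 hx).2)

/-- The Möbius weight of a partition with `c` blocks. -/
def mobiusWeight (c : ℕ) : ℝ := (-1 : ℝ) ^ (c - 1) * (Nat.factorial (c - 1) : ℝ)

/-- `π` respects the relation `E` when related points lie in a common block. -/
def Respects {p : ℕ} (E : Fin p → Fin p → Prop) (π : Finset (Finset (Fin p))) : Prop :=
  ∀ u v, E u v → ∃ B ∈ π, u ∈ B ∧ v ∈ B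

open Classical in
/-- The Möbius weights of the partitions respecting a relation with a proper connected
component sum to zero. -/
theorem sum_mobiusWeight_eq_zero {p : ℕ} (E : Fin p → Fin p → Prop) (A : Finset (Fin p))
    (hA : A.Nonempty) (hA' : A ≠ Finset.univ) (hE : ∀ u v, E u v → (u ∈ A ↔ v ∈ A))
    (hconn : ∀ π ∈ partitions p, Respects E π → ∃ B ∈ π, A ⊆ B) :
    ∑ π ∈ (partitions p).filter (Respects E), mobiusWeight π.card = 0 := by
  obtain ⟨x₀, hx₀⟩ := hA
  obtain ⟨y₀, hy₀⟩ : ∃ y, y ∉ A := by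
    by_contra! h
    exact hA' (Finset.eq_univ_of_forall h)
  rw [← Finset.sum_filter_add_sum_filter_not _ (fun π => A ∈ π)]
  set R₁ := ((partitions p).filter (Respects E)).filter (fun π => A ∈ π) with hR₁
  have hcard : ∀ π ∈ R₁, 2 ≤ π.card := by
    intro π hπ
    simp only [hR₁, Finset.mem_filter, mem_partitions] at hπ
    obtain ⟨⟨⟨h1, h2, h3⟩, hR⟩, hAπ⟩ := hπ
    obtain ⟨B, hB, hyB⟩ := h1 y₀
    have hne : A ≠ B := by
      rintro rfl
      exact hy₀ hyB
    calc 2 = ({A, B} : Finset (Finset (Fin p))).card := (Finset.card_pair hne).symm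
      _ ≤ π.card := Finset.card_le_card (by
        intro C hC
        rcases Finset.mem_insert.1 hC with rfl | hC
        · exact hAπ
        · rw [Finset.mem_singleton.1 hC]
          exact hB)
  have hfirst : ∑ π ∈ R₁, mobiusWeight π.card =
      -∑ x ∈ R₁.sigma (fun π => π.erase A), mobiusWeight (x.1.card - 1) := by
    rw [Finset.sum_sigma, ← Finset.sum_neg_distrib]
    refine Finset.sum_congr rfl fun π hπ => ?_
    have hAπ : A ∈ π := (Finset.mem_filter.1 hπ).2
    dsimp only
    rw [Finset.sum_const, Finset.card_erase_of_mem hAπ]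
    obtain ⟨c, hc⟩ := Nat.exists_eq_add_of_le (hcard π hπ)
    rw [hc]
    simp only [mobiusWeight, show 2 + c - 1 = c + 1 by omega, Nat.add_sub_cancel,
      Nat.factorial_succ, nsmul_eq_mul]
    push_cast
    ring
  rw [hfirst, neg_add_eq_zero]
  have hsig : ∀ x ∈ R₁.sigma (fun π => π.erase A), x.1 ∈ partitions p ∧ Respects E x.1 ∧
      A ∈ x.1 ∧ x.2 ∈ x.1 ∧ x.2 ≠ A := by
    intro x hx
    simp only [hR₁, Finset.mem_sigma, Finset.mem_filter, Finset.mem_erase] at hx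
    tauto
  refine Finset.sum_bij (fun x _ => insert (A ∪ x.2) ((x.1.erase A).erase x.2)) ?_ ?_ ?_ ?_
  · rintro ⟨π, C⟩ hx
    obtain ⟨hπ, hR, hAπ, hC, hCA⟩ := hsig _ hx
    simp only at hπ hR hAπ hC hCA
    obtain ⟨h1, h2, h3⟩ := mem_partitions.1 hπ
    simp only [Finset.mem_filter, mem_partitions]
    have hlift : ∀ B ∈ π, ∃ B' ∈ insert (A ∪ C) ((π.erase A).erase C), B ⊆ B' := by
      intro B hB
      by_cases hBA : B = A
      · exact ⟨A ∪ C, Finset.mem_insert_self _ _, by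
          rw [hBA]; exact Finset.subset_union_left⟩
      by_cases hBC : B = C
      · exact ⟨A ∪ C, Finset.mem_insert_self _ _, by
          rw [hBC]; exact Finset.subset_union_right⟩
      · exact ⟨B, by simp [hBA, hBC, hB], subset_rfl⟩
    refine ⟨⟨⟨?_, ?_, ?_⟩, ?_⟩, ?_⟩
    · intro x
      obtain ⟨B, hB, hxB⟩ := h1 x
      obtain ⟨B', hB', hs⟩ := hlift B hB
      exact ⟨B', hB', hs hxB⟩
    · intro B hB
      rcases Finset.mem_insert.1 hB with rfl | hB
      · exact ⟨x₀, Finset.mem_union_left _ hx₀⟩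
      · exact h2 B (Finset.mem_of_mem_erase (Finset.mem_of_mem_erase hB))
    · have haux : ∀ B ∈ (π.erase A).erase C, ∀ x ∈ B, x ∉ A ∪ C := by
        intro B hB x hxB hx
        simp only [Finset.mem_erase] at hB
        rcases Finset.mem_union.1 hx with hx | hx
        · exact hB.2.1 (h3 B hB.2.2 A hAπ x hxB hx)
        · exact hB.1 (h3 B hB.2.2 C hC x hxB hx)
      intro B hB B' hB' x hxB hxB'
      rcases Finset.mem_insert.1 hB with rfl | hB <;>
        rcases Finset.mem_insert.1 hB' with rfl | hB'
      · rfl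
      · exact absurd hxB (haux _ hB' x hxB')
      · exact absurd hxB' (haux _ hB x hxB)
      · simp only [Finset.mem_erase] at hB hB'
        exact h3 B hB.2.2 B' hB'.2.2 x hxB hxB'
    · intro u v huv
      obtain ⟨B, hB, hu, hv⟩ := hR u v huv
      obtain ⟨B', hB', hs⟩ := hlift B hB
      exact ⟨B', hB', hs hu, hs hv⟩
    · intro hA2
      rcases Finset.mem_insert.1 hA2 with h | h
      · obtain ⟨z, hz⟩ := h2 C hC
        have hzA : z ∈ A := by
          rw [h]
          exact Finset.mem_union_right _ hz
        exact hCA (h3 C hC A hAπ z hz hzA)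
      · simp at h
  · rintro ⟨π, C⟩ hx ⟨π', C'⟩ hx' heq
    obtain ⟨hπ, -, hAπ, hC, hCA⟩ := hsig _ hx
    obtain ⟨hπ', -, hAπ', hC', hCA'⟩ := hsig _ hx'
    simp only at hπ hAπ hC hCA hπ' hAπ' hC' hCA' heq
    obtain ⟨h1, h2, h3⟩ := mem_partitions.1 hπ
    obtain ⟨h1', h2', h3'⟩ := mem_partitions.1 hπ'
    have hd : Disjoint A C := Finset.disjoint_left.2 fun x hxA hxC =>
      hCA (h3 C hC A hAπ x hxC hxA)
    have hd' : Disjoint A C' := Finset.disjoint_left.2 fun x hxA hxC =>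
      hCA' (h3' C' hC' A hAπ' x hxC hxA)
    have hunion : A ∪ C = A ∪ C' := by
      have hmem : A ∪ C ∈ insert (A ∪ C') ((π'.erase A).erase C') := by
        rw [← heq]
        exact Finset.mem_insert_self _ _
      rcases Finset.mem_insert.1 hmem with h | h
      · exact h
      · simp only [Finset.mem_erase] at h
        exact absurd (h3' _ h.2.2 A hAπ' x₀ (Finset.mem_union_left _ hx₀) hx₀) h.2.1
    have hCC : C = C' := by
      rw [← Finset.union_sdiff_cancel_left hd, hunion, Finset.union_sdiff_cancel_left hd']
    subst hCC
    have hnot : ∀ ρ : Finset (Finset (Fin p)), ρ ∈ partitions p → A ∈ ρ →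
        A ∪ C ∉ (ρ.erase A).erase C := by
      intro ρ hρ hAρ h
      simp only [Finset.mem_erase] at h
      exact h.2.1 ((mem_partitions.1 hρ).2.2 _ h.2.2 A hAρ x₀ (Finset.mem_union_left _ hx₀) hx₀)
    have he : (π.erase A).erase C = (π'.erase A).erase C := by
      rw [← Finset.erase_insert (hnot π hπ hAπ), heq, Finset.erase_insert (hnot π' hπ' hAπ')]
    have : π = π' := by
      rw [← Finset.insert_erase hAπ, ← Finset.insert_erase hAπ',
        ← Finset.insert_erase (Finset.mem_erase.2 ⟨hCA, hC⟩),
        ← Finset.insert_erase (Finset.mem_erase.2 ⟨hCA, hC'⟩), he]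
    subst this
    rfl
  · intro π hπ
    simp only [Finset.mem_filter] at hπ
    obtain ⟨⟨hp, hR⟩, hAπ⟩ := hπ
    obtain ⟨B, hB, hAB⟩ := hconn π hp hR
    obtain ⟨h1, h2, h3⟩ := mem_partitions.1 hp
    have hBA : B ≠ A := by
      rintro rfl
      exact hAπ hB
    have hBne : (B \ A).Nonempty := by
      rw [Finset.sdiff_nonempty]
      exact fun h => hBA (subset_antisymm h hAB)
    have hBAπ : B \ A ∉ π := by
      intro h
      obtain ⟨z, hz⟩ := hBne
      have := h3 _ h B hB z hz (Finset.mem_sdiff.1 hz).1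
      have hx : x₀ ∈ B \ A := by
        rw [this]
        exact hAB hx₀
      exact (Finset.mem_sdiff.1 hx).2 hx₀
    have hne : B \ A ≠ A := by
      intro h
      have hx : x₀ ∈ B \ A := by
        rw [h]
        exact hx₀
      exact (Finset.mem_sdiff.1 hx).2 hx₀
    have hdisj : ∀ D ∈ π.erase B, ∀ x ∈ D, x ∉ B := by
      intro D hD x hxD hxB
      exact (Finset.mem_erase.1 hD).1 (h3 D (Finset.mem_of_mem_erase hD) B hB x hxD hxB)
    refine ⟨⟨insert A (insert (B \ A) (π.erase B)), B \ A⟩, ?_, ?_⟩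
    · simp only [hR₁, Finset.mem_sigma, Finset.mem_filter, mem_partitions]
      refine ⟨⟨⟨⟨?_, ?_, ?_⟩, ?_⟩, ?_⟩, ?_⟩
      · intro x
        obtain ⟨D, hD, hxD⟩ := h1 x
        by_cases hDB : D = B
        · by_cases hxA : x ∈ A
          · exact ⟨A, by simp, hxA⟩
          · exact ⟨B \ A, by simp, Finset.mem_sdiff.2 ⟨hDB ▸ hxD, hxA⟩⟩
        · exact ⟨D, by simp [hD, hDB], hxD⟩
      · intro D hD
        rcases Finset.mem_insert.1 hD with rfl | hD
        · exact ⟨x₀, hx₀⟩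
        rcases Finset.mem_insert.1 hD with rfl | hD
        · exact hBne
        · exact h2 D (Finset.mem_of_mem_erase hD)
      · intro D hD D' hD' x hxD hxD'
        rcases Finset.mem_insert.1 hD with rfl | hD <;>
          rcases Finset.mem_insert.1 hD' with rfl | hD'
        · rfl
        · rcases Finset.mem_insert.1 hD' with rfl | hD'
          · exact absurd hxD (Finset.mem_sdiff.1 hxD').2
          · exact absurd (hAB hxD) (hdisj _ hD' x hxD')
        · rcases Finset.mem_insert.1 hD with rfl | hD
          · exact absurd hxD' (Finset.mem_sdiff.1 hxD).2
          · exact absurd (hAB hxD') (hdisj _ hD x hxD)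
        · rcases Finset.mem_insert.1 hD with rfl | hD <;>
            rcases Finset.mem_insert.1 hD' with rfl | hD'
          · rfl
          · exact absurd (Finset.mem_sdiff.1 hxD).1 (hdisj _ hD' x hxD')
          · exact absurd (Finset.mem_sdiff.1 hxD').1 (hdisj _ hD x hxD)
          · exact h3 D (Finset.mem_of_mem_erase hD) D' (Finset.mem_of_mem_erase hD') x hxD hxD'
      · intro u v huv
        obtain ⟨D, hD, hu, hv⟩ := hR u v huv
        by_cases hDB : D = B
        · subst hDB
          by_cases huA : u ∈ A
          · exact ⟨A, by simp, huA, (hE u v huv).1 huA⟩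
          · exact ⟨D \ A, by simp, Finset.mem_sdiff.2 ⟨hu, huA⟩,
              Finset.mem_sdiff.2 ⟨hv, fun h => huA ((hE u v huv).2 h)⟩⟩
        · exact ⟨D, by simp [hD, hDB], hu, hv⟩
      · simp
      · simp [hne]
    · have e1 : (insert A (insert (B \ A) (π.erase B))).erase A = insert (B \ A) (π.erase B) := by
        refine Finset.erase_insert ?_
        simp only [Finset.mem_insert, Finset.mem_erase, not_or, not_and]
        exact ⟨hne.symm, fun _ => hAπ⟩
      have e2 : (insert (B \ A) (π.erase B)).erase (B \ A) = π.erase B := by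
        refine Finset.erase_insert ?_
        simp only [Finset.mem_erase, not_and]
        exact fun _ => hBAπ
      simp only [e1, e2, Finset.union_sdiff_of_subset hAB]
      exact Finset.insert_erase hB
  · rintro ⟨π, C⟩ hx
    obtain ⟨hπ, -, hAπ, hC, hCA⟩ := hsig _ hx
    simp only at hπ hAπ hC hCA
    congr 1
    have hnot : A ∪ C ∉ (π.erase A).erase C := by
      intro h
      simp only [Finset.mem_erase] at h
      exact h.2.1 ((mem_partitions.1 hπ).2.2 _ h.2.2 A hAπ x₀ (Finset.mem_union_left _ hx₀) hx₀)
    rw [Finset.card_insert_of_notMem hnot,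
      Finset.card_erase_of_mem (Finset.mem_erase.2 ⟨hCA, hC⟩), Finset.card_erase_of_mem hAπ]
    have : 2 ≤ π.card := hcard π (Finset.mem_sigma.1 hx).1
    simp only
    omega

/-- The multi-index `k` restricted to the rows in `B`. -/
def restrictRows {ι κ : Type*} [DecidableEq ι] (B : Finset ι) (k : ι × κ → ℕ) : ι × κ → ℕ :=
  fun a => if a.1 ∈ B then k a else 0

open Classical in
/-- The product over the blocks of a partition of block expectations satisfies the Hermite
recursion for the pairing restricted to the blocks. -/
lemma hermiteRec_prod_blocks {p : ℕ} {κ : Type*} [Fintype κ] [DecidableEq κ]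
    {S : Fin p × κ → Fin p × κ → ℝ} {G : (Fin p × κ → ℕ) → ℝ} (hG0 : G 0 = 1)
    (hG : ∀ (k : Fin p × κ → ℕ) a, G (k + Pi.single a 1) =
      ∑ b ∈ Finset.univ.erase a, S a b * k b * G (k - Pi.single b 1))
    (hS : ∀ a b, a ≠ b → a.1 = b.1 → S a b = 0)
    {π : Finset (Finset (Fin p))} (hπ : π ∈ partitions p) :
    HermiteRec Prod.fst (fun a b => if ∃ B ∈ π, a.1 ∈ B ∧ b.1 ∈ B then S a b else 0)
      (fun k => ∏ B ∈ π, G (restrictRows B k)) := by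
  obtain ⟨h1, h2, h3⟩ := mem_partitions.1 hπ
  constructor
  · refine Finset.prod_eq_one fun B _ => ?_
    rw [← hG0]
    congr 1
    ext a
    simp [restrictRows]
  · intro k a
    obtain ⟨B₀, hB₀, haB₀⟩ := h1 a.1
    have hout : ∀ b : Fin p × κ, b.1 ∈ B₀ → ∀ B ∈ π.erase B₀, b.1 ∉ B := by
      intro b hb B hB hbB
      exact (Finset.mem_erase.1 hB).1 (h3 B (Finset.mem_of_mem_erase hB) B₀ hB₀ _ hbB hb)
    have hadd : ∀ B ∈ π.erase B₀, restrictRows B (k + Pi.single a 1) = restrictRows B k := by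
      intro B hB
      ext c
      by_cases hc : c.1 ∈ B
      · have : c ≠ a := by
          rintro rfl
          exact hout _ haB₀ B hB hc
        simp [restrictRows, hc, this]
      · simp [restrictRows, hc]
    have hsub : ∀ b : Fin p × κ, b.1 ∈ B₀ → ∀ B ∈ π.erase B₀,
        restrictRows B (k - Pi.single b 1) = restrictRows B k := by
      intro b hb B hB
      ext c
      by_cases hc : c.1 ∈ B
      · have : c ≠ b := by
          rintro rfl
          exact hout _ hb B hB hc
        simp [restrictRows, hc, this]
      · simp [restrictRows, hc]
    have hadd₀ : restrictRows B₀ (k + Pi.single a 1) = restrictRows B₀ k + Pi.single a 1 := by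
      ext c
      by_cases hc : c.1 ∈ B₀
      · simp [restrictRows, hc]
      · have : c ≠ a := by
          rintro rfl
          exact hc haB₀
        simp [restrictRows, hc, this]
    have hsub₀ : ∀ b : Fin p × κ,
        restrictRows B₀ (k - Pi.single b 1) = restrictRows B₀ k - Pi.single b 1 := by
      intro b
      ext c
      by_cases hc : c.1 ∈ B₀ <;> simp [restrictRows, hc]
    beta_reduce
    rw [← Finset.mul_prod_erase _ _ hB₀, hadd₀, hG, Finset.sum_mul,
      Finset.prod_congr rfl fun B hB => by rw [hadd B hB]]
    have hfil : (Finset.univ.filter fun b : Fin p × κ => a.1 ≠ b.1) ⊆ Finset.univ.erase a := by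
      intro b hb
      refine Finset.mem_erase.2 ⟨?_, Finset.mem_univ _⟩
      rintro rfl
      exact (Finset.mem_filter.1 hb).2 rfl
    rw [← Finset.sum_subset hfil]
    · refine Finset.sum_congr rfl fun b _ => ?_
      by_cases hb : b.1 ∈ B₀
      · rw [if_pos ⟨B₀, hB₀, haB₀, hb⟩, ← Finset.mul_prod_erase _ _ hB₀, hsub₀ b,
          ← Finset.prod_congr rfl fun B hB => congrArg G (hsub b hb B hB)]
        simp only [restrictRows, if_pos hb]
        ring
      · rw [if_neg]
        · simp [restrictRows, hb]
        · rintro ⟨B, hB, haB, hbB⟩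
          rw [h3 B hB B₀ hB₀ _ haB haB₀] at hbB
          exact hb hbB
    · intro b hb hb'
      rw [hS a b (Finset.mem_erase.1 hb).1.symm (by simpa using hb')]
      simp

/-- A diagram on the rows `Fin p` is connected when no proper nonempty set of rows is
closed under its edges. -/
def DiagramConnected {p : ℕ} {κ : Type*} (l : (Fin p × κ) × (Fin p × κ) →₀ ℕ) : Prop :=
  ∀ A : Finset (Fin p), A.Nonempty → (∀ e, l e ≠ 0 → (e.1.1 ∈ A ↔ e.2.1 ∈ A)) → A = Finset.univ

open Classical in
lemma sum_mobiusWeight_diagram_eq_zero {p : ℕ} {κ : Type*}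
    {l : (Fin p × κ) × (Fin p × κ) →₀ ℕ} (hl : ¬ DiagramConnected l) :
    ∑ π ∈ (partitions p).filter (Respects fun u v => ∃ e, l e ≠ 0 ∧ e.1.1 = u ∧ e.2.1 = v),
      mobiusWeight π.card = 0 := by
  simp only [DiagramConnected] at hl
  push Not at hl
  obtain ⟨A₁, hA₁, hA₁', hA₁''⟩ := hl
  obtain ⟨A, hA, hmin⟩ := Finset.exists_min_image
    (Finset.univ.filter fun A : Finset (Fin p) => A.Nonempty ∧
      (∀ e, l e ≠ 0 → (e.1.1 ∈ A ↔ e.2.1 ∈ A)) ∧ A ≠ Finset.univ) Finset.card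
    ⟨A₁, by simpa using ⟨hA₁, fun a b c d h => hA₁' _ h, hA₁''⟩⟩
  obtain ⟨hne, hcl, hun⟩ := (Finset.mem_filter.1 hA).2
  refine sum_mobiusWeight_eq_zero _ A hne hun ?_ ?_
  · rintro u v ⟨e, he, rfl, rfl⟩
    exact hcl e he
  · intro π hπ hR
    obtain ⟨h1, h2, h3⟩ := mem_partitions.1 hπ
    obtain ⟨x, hx⟩ := hne
    obtain ⟨B, hB, hxB⟩ := h1 x
    refine ⟨B, hB, ?_⟩
    have hle := hmin (A ∩ B) (by
      refine Finset.mem_filter.2 ⟨Finset.mem_univ _, ⟨x, Finset.mem_inter.2 ⟨hx, hxB⟩⟩, ?_, ?_⟩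
      · intro e he
        obtain ⟨B', hB', hu, hv⟩ := hR _ _ ⟨e, he, rfl, rfl⟩
        have : e.1.1 ∈ B ↔ e.2.1 ∈ B := by
          constructor
          · intro h
            rwa [h3 B hB B' hB' _ h hu]
          · intro h
            rwa [h3 B hB B' hB' _ h hv]
        rw [Finset.mem_inter, Finset.mem_inter, hcl e he, this]
      · intro h
        exact hun (Finset.univ_subset_iff.1 (h ▸ Finset.inter_subset_left)))
    exact Finset.inter_eq_left.1 (Finset.eq_of_subset_of_card_le Finset.inter_subset_left hle)

open Classical in
/-- The diagram bound for cumulants: only connected diagrams contribute. -/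
theorem exists_diagram_bound {p : ℕ} {κ : Type*} [Fintype κ] [DecidableEq κ] (k : Fin p × κ → ℕ) :
    ∃ (D : Finset ((Fin p × κ) × (Fin p × κ) →₀ ℕ))
      (C : ((Fin p × κ) × (Fin p × κ) →₀ ℕ) → ℝ),
      (∀ l ∈ D, 0 ≤ C l ∧ (∀ e, l e ≠ 0 → e.1.1 ≠ e.2.1) ∧
        (∀ c, ∑ d, (l (c, d) + l (d, c)) = k c) ∧ DiagramConnected l) ∧
      ∀ (S : Fin p × κ → Fin p × κ → ℝ) (G : (Fin p × κ → ℕ) → ℝ), G 0 = 1 →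
        (∀ (k : Fin p × κ → ℕ) a, G (k + Pi.single a 1) =
          ∑ b ∈ Finset.univ.erase a, S a b * k b * G (k - Pi.single b 1)) →
        (∀ a b, a ≠ b → a.1 = b.1 → S a b = 0) →
        |∑ π ∈ partitions p, mobiusWeight π.card * ∏ B ∈ π, G (restrictRows B k)| ≤
          ∑ l ∈ D, C l * ∏ e, |S e.1 e.2| ^ (l e) := by
  obtain ⟨Φ, hΦ, hΦ'⟩ := exists_diagram_polynomial (Prod.fst : Fin p × κ → Fin p) k
  refine ⟨Φ.support.filter DiagramConnected,
    fun l => |Φ.coeff l| * ∑ π ∈ partitions p, |mobiusWeight π.card|, ?_, ?_⟩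
  · intro l hl
    obtain ⟨hl1, hl2⟩ := Finset.mem_filter.1 hl
    obtain ⟨h1, h2⟩ := hΦ' l (MvPolynomial.mem_support_iff.1 hl1)
    exact ⟨by positivity, h1, h2, hl2⟩
  · intro S G hG0 hG hS
    have hmono : ∀ (π : Finset (Finset (Fin p))) (l : (Fin p × κ) × (Fin p × κ) →₀ ℕ),
        (∏ e, (if ∃ B ∈ π, e.1.1 ∈ B ∧ e.2.1 ∈ B then S e.1 e.2 else 0) ^ (l e)) =
          if Respects (fun u v => ∃ e, l e ≠ 0 ∧ e.1.1 = u ∧ e.2.1 = v) π then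
            ∏ e, S e.1 e.2 ^ (l e) else 0 := by
      intro π l
      split_ifs with hR
      · refine Finset.prod_congr rfl fun e _ => ?_
        by_cases he : l e = 0
        · simp [he]
        · rw [if_pos (hR _ _ ⟨e, he, rfl, rfl⟩)]
      · simp only [Respects] at hR
        push Not at hR
        obtain ⟨u, v, ⟨e, he, rfl, rfl⟩, hB⟩ := hR
        refine Finset.prod_eq_zero (Finset.mem_univ e) ?_
        rw [if_neg, zero_pow he]
        rintro ⟨B, hB1, hB2, hB3⟩
        exact hB B hB1 hB2 hB3
    have hexp : ∑ π ∈ partitions p, mobiusWeight π.card * ∏ B ∈ π, G (restrictRows B k) =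
        ∑ l ∈ Φ.support, Φ.coeff l * (∏ e, S e.1 e.2 ^ (l e)) *
          ∑ π ∈ (partitions p).filter
            (Respects fun u v => ∃ e, l e ≠ 0 ∧ e.1.1 = u ∧ e.2.1 = v),
            mobiusWeight π.card := by
      calc _ = ∑ π ∈ partitions p, ∑ l ∈ Φ.support, mobiusWeight π.card * (Φ.coeff l *
            if Respects (fun u v => ∃ e, l e ≠ 0 ∧ e.1.1 = u ∧ e.2.1 = v) π then
              ∏ e, S e.1 e.2 ^ (l e) else 0) := by
            refine Finset.sum_congr rfl fun π hπ => ?_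
            rw [hΦ _ _ (hermiteRec_prod_blocks hG0 hG hS hπ), MvPolynomial.eval_eq', Finset.mul_sum]
            refine Finset.sum_congr rfl fun l _ => ?_
            rw [← hmono]
        _ = _ := by
            rw [Finset.sum_comm]
            refine Finset.sum_congr rfl fun l _ => ?_
            rw [Finset.sum_filter, Finset.mul_sum]
            refine Finset.sum_congr rfl fun π _ => ?_
            split_ifs
            · ring
            · simp
    rw [hexp]
    refine (Finset.abs_sum_le_sum_abs _ _).trans ?_
    rw [Finset.sum_filter]
    refine Finset.sum_le_sum fun l _ => ?_
    split_ifs with hl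
    · rw [abs_mul, abs_mul, Finset.abs_prod, mul_right_comm]
      simp only [abs_pow]
      refine mul_le_mul_of_nonneg_right (mul_le_mul_of_nonneg_left ?_ (abs_nonneg _))
        (by positivity)
      exact (Finset.abs_sum_le_sum_abs _ _).trans
        (Finset.sum_le_sum_of_subset_of_nonneg (Finset.filter_subset _ _)
          fun _ _ _ => abs_nonneg _)
    · rw [sum_mobiusWeight_diagram_eq_zero hl]
      simp

/-- Gaussianity of all linear combinations gives Gaussianity of the vector. -/
lemma IsJointGaussian.hasGaussianLaw {Ω ι : Type*} [MeasurableSpace Ω] {P : Measure Ω} [Fintype ι]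
    {X : ι → Ω → ℝ} (h : IsJointGaussian P X) (hX : ∀ i, Measurable (X i)) :
    HasGaussianLaw (fun ω i => X i ω) P := by
  classical
  have hm : Measurable (fun ω i => X i ω) := measurable_pi_lambda _ hX
  refine ⟨?_⟩
  refine isGaussian_of_map_eq_gaussianReal fun L => ?_
  obtain ⟨μ, v, hμ⟩ := h Finset.univ (fun i => L (Pi.single i 1))
  refine ⟨μ, v, ?_⟩
  rw [Measure.map_map (by fun_prop) hm, ← hμ]
  congr 1
  ext ω
  have := L.toLinearMap.pi_apply_eq_sum_univ (fun i => X i ω)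
  simp only [ContinuousLinearMap.coe_coe, smul_eq_mul] at this
  rw [Function.comp_apply, this]
  refine Finset.sum_congr rfl fun i _ => ?_
  rw [mul_comm]
  congr 2
  ext j
  simp [Pi.single_apply, eq_comm]

lemma jointCumulant_hermiteProd_eq {Ω : Type*} [MeasurableSpace Ω] (P : Measure Ω) {p ν : ℕ}
    (Y : Fin p × Fin ν → Ω → ℝ) (k : Fin p → Fin ν → ℕ) :
    jointCumulant P (fun u ω => hermiteProd (k u) (fun i => Y (u, i) ω)) =
      ∑ π ∈ partitions p, mobiusWeight π.card * ∏ B ∈ π,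
        ∫ ω, ∏ c, hermiteFun (restrictRows B (fun a => k a.1 a.2) c) (Y c ω) ∂P := by
  unfold jointCumulant partitions mobiusWeight
  refine Finset.sum_congr rfl fun π _ => ?_
  congr 1
  refine Finset.prod_congr rfl fun B _ => ?_
  congr 1
  ext ω
  rw [Fintype.prod_prod_type, ← Finset.prod_subset (Finset.subset_univ B)]
  · refine Finset.prod_congr rfl fun u hu => ?_
    simp [hermiteProd, restrictRows, hu]
  · intro u _ hu
    simp [restrictRows, hu, hermiteFun]

/-- Joint cumulants of Hermite polynomials of standardized Gaussian vectors are bounded by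
a sum over connected diagrams. -/
theorem exists_cumulant_bound {p ν : ℕ} (k : Fin p → Fin ν → ℕ) :
    ∃ (D : Finset ((Fin p × Fin ν) × (Fin p × Fin ν) →₀ ℕ))
      (C : ((Fin p × Fin ν) × (Fin p × Fin ν) →₀ ℕ) → ℝ),
      (∀ l ∈ D, 0 ≤ C l ∧ (∀ e, l e ≠ 0 → e.1.1 ≠ e.2.1) ∧
        (∀ c, ∑ d, (l (c, d) + l (d, c)) = k c.1 c.2) ∧ DiagramConnected l) ∧
      ∀ {Ω : Type} [MeasurableSpace Ω] (P : Measure Ω) [IsProbabilityMeasure P]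
        (Y : Fin p × Fin ν → Ω → ℝ), HasGaussianLaw (fun ω a => Y a ω) P →
        (∀ a, ∫ ω, Y a ω ∂P = 0) →
        (∀ u i j, ∫ ω, Y (u, i) ω * Y (u, j) ω ∂P = if i = j then 1 else 0) →
        |jointCumulant P (fun u ω => hermiteProd (k u) (fun i => Y (u, i) ω))| ≤
          ∑ l ∈ D, C l * ∏ e, |∫ ω, Y e.1 ω * Y e.2 ω ∂P| ^ (l e) := by
  obtain ⟨D, C, hD, hb⟩ := exists_diagram_bound (fun a : Fin p × Fin ν => k a.1 a.2)
  refine ⟨D, C, hD, ?_⟩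
  intro Ω _ P _ Y hG hc hstd
  rw [jointCumulant_hermiteProd_eq]
  refine hb (fun a b => ∫ ω, Y a ω * Y b ω ∂P)
    (fun q => ∫ ω, ∏ c, hermiteFun (q c) (Y c ω) ∂P) ?_ ?_ ?_
  · simp [hermiteFun]
  · exact integral_hermite_add_single hG hc (fun a => by simpa using hstd a.1 a.2 a.2)
  · rintro ⟨u, i⟩ ⟨v, j⟩ hne huv
    simp only at huv
    subst huv
    have : i ≠ j := fun h => hne (by rw [h])
    simp [hstd, this]

/-- Hölder's inequality for finitely many functions, with upper bounds for the norms. -/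
lemma sum_prod_rpow_le {α ι : Type*} (S : Finset α) (I : Finset ι) {N : ℝ} (hN : 0 < N)
    (hS : (S.card : ℝ) ≤ N) {w C : ι → ℝ} {f : ι → α → ℝ} (hw : ∀ i ∈ I, 0 ≤ w i)
    (hw1 : ∑ i ∈ I, w i ≤ 1) (hC : ∀ i ∈ I, 0 < C i) (hf : ∀ i ∈ I, ∀ t ∈ S, 0 ≤ f i t)
    (hfC : ∀ i ∈ I, w i ≠ 0 → ∑ t ∈ S, f i t ≤ C i) :
    ∑ t ∈ S, ∏ i ∈ I, f i t ^ w i ≤ N ^ (1 - ∑ i ∈ I, w i) * ∏ i ∈ I, C i ^ w i := by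
  have hpos : 0 < N ^ (1 - ∑ i ∈ I, w i) * ∏ i ∈ I, C i ^ w i :=
    mul_pos (Real.rpow_pos_of_pos hN _)
      (Finset.prod_pos fun i hi => Real.rpow_pos_of_pos (hC i hi) _)
  rw [← div_le_one hpos, Finset.sum_div]
  have hpt : ∀ t ∈ S, (∏ i ∈ I, f i t ^ w i) / (N ^ (1 - ∑ i ∈ I, w i) * ∏ i ∈ I, C i ^ w i) ≤
      (1 - ∑ i ∈ I, w i) * N⁻¹ + ∑ i ∈ I, w i * (f i t / C i) := by
    intro t ht
    have h := Real.geom_mean_le_arith_mean_weighted (Finset.insertNone I)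
      (fun o => o.elim (1 - ∑ i ∈ I, w i) w) (fun o => o.elim N⁻¹ (fun i => f i t / C i))
      (by
        rintro (_ | i) hi
        · simpa using hw1
        · exact hw i (by simpa using hi))
      (by simp [Finset.sum_insertNone])
      (by
        rintro (_ | i) hi
        · simpa using hN.le
        · have hi' : i ∈ I := by simpa using hi
          exact div_nonneg (hf i hi' t ht) (hC i hi').le)
    rw [Finset.prod_insertNone, Finset.sum_insertNone] at h
    simp only [Option.elim] at h
    refine le_trans (le_of_eq ?_) h
    rw [Real.inv_rpow hN.le, Finset.prod_congr rfl fun i hi =>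
      Real.div_rpow (hf i hi t ht) (hC i hi).le (w i), Finset.prod_div_distrib]
    field_simp
  refine (Finset.sum_le_sum hpt).trans ?_
  rw [Finset.sum_add_distrib, Finset.sum_const, nsmul_eq_mul, Finset.sum_comm]
  have h1 : (S.card : ℝ) * ((1 - ∑ i ∈ I, w i) * N⁻¹) ≤ 1 - ∑ i ∈ I, w i := by
    rw [mul_left_comm]
    refine mul_le_of_le_one_right (by linarith) ?_
    rw [← div_eq_mul_inv]
    exact (div_le_one hN).2 hS
  have h2 : ∑ i ∈ I, ∑ t ∈ S, w i * (f i t / C i) ≤ ∑ i ∈ I, w i := by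
    refine Finset.sum_le_sum fun i hi => ?_
    by_cases hwi : w i = 0
    · simp [hwi]
    · rw [← Finset.mul_sum, ← Finset.sum_div]
      exact mul_le_of_le_one_right (hw i hi) ((div_le_one (hC i hi)).2 (hfC i hi hwi))
  linarith

lemma sum_piFinset_fin_succ {α M : Type*} [AddCommMonoid M] {p : ℕ}
    (S : Fin (p + 1) → Finset α) (f : (Fin (p + 1) → α) → M) :
    ∑ t ∈ Fintype.piFinset S, f t =
      ∑ t ∈ Fintype.piFinset (fun i : Fin p => S i.succ), ∑ s ∈ S 0,
        f (Fin.cons s t : Fin (p + 1) → α) := by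
  classical
  rw [← Finset.sum_product']
  refine Finset.sum_nbij' (fun t => (Fin.tail t, t 0))
    (fun x => (Fin.cons x.2 x.1 : Fin (p + 1) → α)) ?_ ?_ ?_ ?_ ?_
  · intro t ht
    rw [Fintype.mem_piFinset] at ht
    simp [Fin.tail, ht]
  · rintro ⟨t, s⟩ ht
    rw [Fintype.mem_piFinset]
    simp only [Finset.mem_product, Fintype.mem_piFinset] at ht
    exact Fin.cases (by simpa using ht.2) (fun i => by simpa using ht.1 i)
  · intro t _
    simp
  · rintro ⟨t, s⟩ _
    simp
  · intro t _
    simp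

/-- Iterated Hölder bound for sums of products of pair interactions. -/
theorem sum_prod_pairs_le {α : Type*} {p : ℕ} (S : Fin p → Finset α) {N : Fin p → ℝ}
    {d : Fin p → ℕ} {C : Fin p → Fin p → ℝ} (L : Fin p → Fin p → ℕ)
    (F : Fin p → Fin p → α → α → ℝ) (hd : ∀ u, 0 < d u) (hN : ∀ u, 0 < N u)
    (hS : ∀ u, ((S u).card : ℝ) ≤ N u) (hC : ∀ u v, 0 < C u v) (hF : ∀ u v s t, 0 ≤ F u v s t)
    (hFC : ∀ u v, u < v → L u v ≠ 0 → ∀ t ∈ S v, ∑ s ∈ S u, F u v s t ^ d u ≤ C u v)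
    (hL : ∀ u, ∑ v ∈ Finset.Ioi u, L u v ≤ d u) :
    ∑ t ∈ Fintype.piFinset S, ∏ u, ∏ v ∈ Finset.Ioi u, F u v (t u) (t v) ^ L u v ≤
      ∏ u, (N u ^ (1 - (∑ v ∈ Finset.Ioi u, L u v : ℕ) / (d u : ℝ)) *
        ∏ v ∈ Finset.Ioi u, C u v ^ ((L u v : ℝ) / d u)) := by
  induction p with
  | zero => simp
  | succ p ih =>
    rw [sum_piFinset_fin_succ, Fin.prod_univ_succ]
    have hd0 : (0 : ℝ) < d 0 := by exact_mod_cast hd 0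
    set R : ℝ := N 0 ^ (1 - (∑ v ∈ Finset.Ioi (0 : Fin (p + 1)), L 0 v : ℕ) / (d 0 : ℝ)) *
        ∏ v ∈ Finset.Ioi (0 : Fin (p + 1)), C 0 v ^ ((L 0 v : ℝ) / d 0) with hR
    have hinner : ∀ t ∈ Fintype.piFinset (fun i : Fin p => S i.succ),
        ∑ s ∈ S 0, ∏ v : Fin p, F 0 v.succ s (t v) ^ L 0 v.succ ≤ R := by
      intro t ht
      rw [Fintype.mem_piFinset] at ht
      have hw : ∑ v : Fin p, (L 0 v.succ : ℝ) / d 0 =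
          (∑ v ∈ Finset.Ioi (0 : Fin (p + 1)), L 0 v : ℕ) / (d 0 : ℝ) := by
        rw [← Finset.sum_div, Fin.sum_Ioi_zero]
        push_cast
        rfl
      have h := sum_prod_rpow_le (S 0) (Finset.univ : Finset (Fin p)) (hN 0) (hS 0)
        (w := fun v => (L 0 v.succ : ℝ) / d 0) (C := fun v => C 0 v.succ)
        (f := fun v s => F 0 v.succ s (t v) ^ d 0) (fun v _ => by positivity)
        (by
          rw [hw, div_le_one hd0]
          exact_mod_cast hL 0)
        (fun v _ => hC _ _) (fun v _ s _ => pow_nonneg (hF _ _ _ _) _)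
        (fun v _ hv => hFC 0 v.succ (Fin.succ_pos v)
          (fun h0 => hv (by simp [h0])) (t v) (ht v))
      rw [hw] at h
      rw [hR, Fin.prod_Ioi_zero]
      refine le_trans (le_of_eq ?_) h
      refine Finset.sum_congr rfl fun s _ => Finset.prod_congr rfl fun v _ => ?_
      rw [← Real.rpow_natCast _ (d 0), ← Real.rpow_mul (hF _ _ _ _), mul_div_cancel₀ _ hd0.ne',
        Real.rpow_natCast]
    have hR0 : 0 ≤ R := mul_nonneg (Real.rpow_nonneg (hN 0).le _)
      (Finset.prod_nonneg fun v _ => Real.rpow_nonneg (hC _ _).le _)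
    have ih' := ih (fun i => S i.succ) (N := fun i => N i.succ) (d := fun i => d i.succ)
      (C := fun u v => C u.succ v.succ) (fun u v => L u.succ v.succ)
      (fun u v => F u.succ v.succ) (fun u => hd _) (fun u => hN _) (fun u => hS _)
      (fun u v => hC _ _) (fun u v s t => hF _ _ _ _)
      (fun u v huv => hFC _ _ (Fin.succ_lt_succ_iff.2 huv))
      (fun u => by simpa [Fin.sum_Ioi_succ] using hL u.succ)
    calc _ = ∑ t ∈ Fintype.piFinset (fun i : Fin p => S i.succ),
          (∑ s ∈ S 0, ∏ v : Fin p, F 0 v.succ s (t v) ^ L 0 v.succ) *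
            ∏ u, ∏ v ∈ Finset.Ioi u, F u.succ v.succ (t u) (t v) ^ L u.succ v.succ := by
          refine Finset.sum_congr rfl fun t _ => ?_
          rw [Finset.sum_mul]
          refine Finset.sum_congr rfl fun s _ => ?_
          rw [Fin.prod_univ_succ]
          simp [Fin.prod_Ioi_succ]
      _ ≤ ∑ t ∈ Fintype.piFinset (fun i : Fin p => S i.succ),
          R * ∏ u, ∏ v ∈ Finset.Ioi u, F u.succ v.succ (t u) (t v) ^ L u.succ v.succ := by
          refine Finset.sum_le_sum fun t ht => mul_le_mul_of_nonneg_right (hinner t ht) ?_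
          exact Finset.prod_nonneg fun u _ => Finset.prod_nonneg fun v _ =>
            pow_nonneg (hF _ _ _ _) _
      _ ≤ _ := by
          rw [← Finset.mul_sum]
          refine mul_le_mul_of_nonneg_left (ih'.trans (le_of_eq ?_)) hR0
          simp [Fin.prod_Ioi_succ, Fin.sum_Ioi_succ]

/-- With vertices ordered by increasing degree, the edges leading upwards account for at least
half of the normalized degrees. -/
lemma half_le_sum_up_degree {p : ℕ} {L : Fin p → Fin p → ℕ} {d : Fin p → ℕ}
    (hsymm : ∀ u v, L u v = L v u) (hdiag : ∀ u, L u u = 0) (hdeg : ∀ u, ∑ v, L u v = d u)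
    (hd : ∀ u, 0 < d u) (hmono : Monotone d) :
    (p : ℝ) / 2 ≤ ∑ u, ((∑ v ∈ Finset.Ioi u, L u v : ℕ) : ℝ) / d u := by
  have hd' : ∀ u, (0 : ℝ) < d u := fun u => by exact_mod_cast hd u
  have h1 : ∑ u, ∑ v ∈ Finset.Ioi u, ((L v u : ℝ) / d v + (L u v : ℝ) / d u) = p := by
    rw [Finset.sum_sum_Ioi_add_eq_sum_sum_off_diag (fun v u => (L v u : ℝ) / d v)]
    have h2 : ∀ u : Fin p, ∑ v ∈ ({u}ᶜ : Finset (Fin p)), (L v u : ℝ) / d v =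
        ∑ v, (L v u : ℝ) / d v := by
      intro u
      refine Finset.sum_subset (Finset.subset_univ _) fun v _ hv => ?_
      have : v = u := by simpa using hv
      simp [this, hdiag]
    rw [Finset.sum_congr rfl fun u _ => h2 u, Finset.sum_comm]
    have h3 : ∀ v : Fin p, ∑ u, (L v u : ℝ) / d v = 1 := by
      intro v
      rw [← Finset.sum_div, div_eq_one_iff_eq (hd' v).ne']
      exact_mod_cast hdeg v
    rw [Finset.sum_congr rfl fun v _ => h3 v]
    simp
  rw [← h1, Finset.sum_div]
  refine Finset.sum_le_sum fun u _ => ?_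
  push_cast
  rw [Finset.sum_div, Finset.sum_div]
  refine Finset.sum_le_sum fun v hv => ?_
  have huv : d u ≤ d v := hmono (Finset.mem_Ioi.1 hv).le
  have : (L v u : ℝ) / d v ≤ (L u v : ℝ) / d u := by
    rw [hsymm v u]
    exact div_le_div_of_nonneg_left (by positivity) (hd' u) (by exact_mod_cast huv)
  linarith

/-- The Hölder bound in the form used for small sets of sites or small row sums: the factor
`x u` records the gain at the vertex `u`. -/
lemma sum_prod_pairs_le_rpow_half {α : Type*} {p : ℕ} {L : Fin p → Fin p → ℕ} {d : Fin p → ℕ}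
    (hsymm : ∀ u v, L u v = L v u) (hdiag : ∀ u, L u u = 0) (hdeg : ∀ u, ∑ v, L u v = d u)
    (hd : ∀ u, 0 < d u) (hmono : Monotone d) (S : Fin p → Finset α) {n M : ℝ} (hn : 1 ≤ n)
    (hM : 1 ≤ M) {η x : Fin p → ℝ} {C : Fin p → Fin p → ℝ} (F : Fin p → Fin p → α → α → ℝ)
    (hη : ∀ u, 0 < η u) (hS : ∀ u, ((S u).card : ℝ) ≤ n * η u) (hC : ∀ u v, 0 < C u v)
    (hF : ∀ u v s t, 0 ≤ F u v s t)
    (hFC : ∀ u v, u < v → L u v ≠ 0 → ∀ t ∈ S v, ∑ s ∈ S u, F u v s t ^ d u ≤ C u v)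
    (hx0 : ∀ u, 0 ≤ x u)
    (hx : ∀ u, η u ^ (1 - ((∑ v ∈ Finset.Ioi u, L u v : ℕ) : ℝ) / d u) *
      ∏ v ∈ Finset.Ioi u, C u v ^ ((L u v : ℝ) / d u) ≤
        x u * M ^ (((∑ v ∈ Finset.Ioi u, L u v : ℕ) : ℝ) / d u)) :
    ∑ t ∈ Fintype.piFinset S, ∏ u, ∏ v ∈ Finset.Ioi u, F u v (t u) (t v) ^ L u v ≤
      n ^ ((p : ℝ) / 2) * ((∏ u, x u) * M ^ p) := by
  have hn0 : 0 < n := by linarith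
  have hM0 : 0 < M := by linarith
  have hd' : ∀ u, (0 : ℝ) < d u := fun u => by exact_mod_cast hd u
  have hL : ∀ u, ∑ v ∈ Finset.Ioi u, L u v ≤ d u := fun u => by
    rw [← hdeg u]
    exact Finset.sum_le_sum_of_subset (Finset.subset_univ _)
  refine (sum_prod_pairs_le S L F hd (fun u => mul_pos hn0 (hη u)) hS hC hF hFC hL).trans ?_
  set g : Fin p → ℝ := fun u => ((∑ v ∈ Finset.Ioi u, L u v : ℕ) : ℝ) / d u with hg
  have hg1 : ∀ u, g u ≤ 1 := fun u => by
    simp only [hg]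
    rw [div_le_one (hd' u)]
    exact_mod_cast hL u
  calc _ ≤ ∏ u, (n ^ (1 - g u) * (x u * M ^ g u)) := by
        refine Finset.prod_le_prod (fun u _ => ?_) fun u _ => ?_
        · exact mul_nonneg (Real.rpow_nonneg (mul_pos hn0 (hη u)).le _)
            (Finset.prod_nonneg fun v _ => Real.rpow_nonneg (hC u v).le _)
        · rw [Real.mul_rpow hn0.le (hη u).le, mul_assoc]
          exact mul_le_mul_of_nonneg_left (hx u) (Real.rpow_nonneg hn0.le _)
    _ = (∏ u, n ^ (1 - g u)) * ((∏ u, x u) * ∏ u, M ^ g u) := by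
        rw [Finset.prod_mul_distrib, Finset.prod_mul_distrib]
    _ ≤ _ := by
        refine mul_le_mul ?_ (mul_le_mul_of_nonneg_left ?_ (Finset.prod_nonneg fun u _ => hx0 u))
          (mul_nonneg (Finset.prod_nonneg fun u _ => hx0 u)
            (Finset.prod_nonneg fun u _ => Real.rpow_nonneg hM0.le _))
          (Real.rpow_nonneg hn0.le _)
        · rw [← Real.rpow_sum_of_pos hn0]
          refine Real.rpow_le_rpow_of_exponent_le hn ?_
          have := half_le_sum_up_degree hsymm hdiag hdeg hd hmono
          simp only [Finset.sum_sub_distrib, Finset.sum_const, Finset.card_univ,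
            Fintype.card_fin, nsmul_eq_mul, mul_one, hg]
          linarith
        · calc ∏ u, M ^ g u ≤ ∏ _u : Fin p, M := by
                refine Finset.prod_le_prod (fun u _ => Real.rpow_nonneg hM0.le _) fun u _ => ?_
                calc M ^ g u ≤ M ^ (1 : ℝ) := Real.rpow_le_rpow_of_exponent_le hM (hg1 u)
                  _ = M := Real.rpow_one M
            _ = M ^ p := by simp

lemma exists_near_radius {p : ℕ} {L : Fin p → Fin p → ℕ}
    (hconn : ∀ A : Finset (Fin p), A.Nonempty → (∀ u v, L u v ≠ 0 → (u ∈ A ↔ v ∈ A)) →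
      A = Finset.univ) (o : Fin p) (K : ℕ) :
    ∃ D : ℕ, ∀ t : Fin p → ℤ, (∀ u v, L u v ≠ 0 → |t u - t v| ≤ (K : ℤ)) →
      ∀ u, |t u - t o| ≤ D := by
  classical
  have huniv := hconn (Finset.univ.filter fun u => ∃ D : ℕ, ∀ t : Fin p → ℤ,
    (∀ u v, L u v ≠ 0 → |t u - t v| ≤ (K : ℤ)) → |t u - t o| ≤ D)
    ⟨o, Finset.mem_filter.2 ⟨Finset.mem_univ _, 0, fun t _ => by simp⟩⟩ (by
      intro u v huv
      simp only [Finset.mem_filter, Finset.mem_univ, true_and]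
      constructor
      · rintro ⟨D, hD⟩
        refine ⟨D + K, fun t ht => ?_⟩
        have h1 := hD t ht
        have h2 := ht u v huv
        rw [abs_le] at h1 h2 ⊢
        push_cast
        constructor <;> linarith
      · rintro ⟨D, hD⟩
        refine ⟨D + K, fun t ht => ?_⟩
        have h1 := hD t ht
        have h2 := ht u v huv
        rw [abs_le] at h1 h2 ⊢
        push_cast
        constructor <;> linarith)
  have hall : ∀ u, ∃ D : ℕ, ∀ t : Fin p → ℤ,
      (∀ u v, L u v ≠ 0 → |t u - t v| ≤ (K : ℤ)) → |t u - t o| ≤ D := fun u => by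
    have : u ∈ (Finset.univ : Finset (Fin p)) := Finset.mem_univ u
    rw [← huniv] at this
    exact (Finset.mem_filter.1 this).2
  choose D hD using hall
  refine ⟨∑ u, D u, fun t ht u => (hD u t ht).trans ?_⟩
  exact_mod_cast Finset.single_le_sum (f := D) (fun _ _ => Nat.zero_le _) (Finset.mem_univ u)

open Classical in
/-- For a connected multigraph, the number of configurations all of whose edges are short grows
at most linearly in the number of sites. -/
lemma exists_card_near_le {p : ℕ} (hp : 0 < p) {L : Fin p → Fin p → ℕ}
    (hconn : ∀ A : Finset (Fin p), A.Nonempty → (∀ u v, L u v ≠ 0 → (u ∈ A ↔ v ∈ A)) →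
      A = Finset.univ) (K : ℕ) :
    ∃ c : ℕ, ∀ I : Finset ℤ, ((Fintype.piFinset fun _ : Fin p => I).filter
      fun t => ∀ u v, L u v ≠ 0 → |t u - t v| ≤ (K : ℤ)).card ≤ I.card * c := by
  obtain ⟨D, hD⟩ := exists_near_radius hconn ⟨0, hp⟩ K
  refine ⟨(2 * D + 1) ^ p, fun I => ?_⟩
  calc _ ≤ (I.biUnion fun s => Fintype.piFinset fun _ : Fin p =>
        Finset.Icc (s - D) (s + D)).card := by
        refine Finset.card_le_card fun t ht => ?_
        obtain ⟨h1, h2⟩ := Finset.mem_filter.1 ht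
        rw [Fintype.mem_piFinset] at h1
        refine Finset.mem_biUnion.2 ⟨t ⟨0, hp⟩, h1 _, Fintype.mem_piFinset.2 fun u => ?_⟩
        have := abs_le.1 (hD t h2 u)
        rw [Finset.mem_Icc]
        constructor <;> linarith
    _ ≤ ∑ s ∈ I, (2 * D + 1) ^ p := by
        refine Finset.card_biUnion_le.trans (Finset.sum_le_sum fun s _ => le_of_eq ?_)
        rw [Fintype.card_piFinset_const, Int.card_Icc]
        congr 1
        omega
    _ = I.card * (2 * D + 1) ^ p := by simp

open Classical in
/-- Gain from restricting one vertex with a lower neighbour to a small set of sites. -/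
lemma sum_prod_pairs_small_site_le {p : ℕ} {L : Fin p → Fin p → ℕ} {d : Fin p → ℕ} {m : ℕ}
    (hsymm : ∀ u v, L u v = L v u) (hdiag : ∀ u, L u u = 0) (hdeg : ∀ u, ∑ v, L u v = d u)
    (hd : ∀ u, 0 < d u) (hdm : ∀ u, m ≤ d u) (hmono : Monotone d) {ρ : ℤ → ℤ → ℝ}
    (hρ0 : ∀ s t, 0 ≤ ρ s t) (hρ1 : ∀ s t, ρ s t ≤ 1) {I B : Finset ℤ} {n M δ κ : ℝ}
    (hn : 1 ≤ n) (hM : 1 ≤ M) (hI : (I.card : ℝ) ≤ n) (hBI : B ⊆ I)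
    (hB : (B.card : ℝ) ≤ n * δ) (hδ : 0 < δ) (hδ1 : δ ≤ 1) (hκ : ∀ u, κ ≤ 1 / (d u : ℝ))
    (hrow : ∀ t ∈ I, ∑ s ∈ I, ρ s t ^ m ≤ M) {a b : Fin p} (hab : a < b) (hLab : L a b ≠ 0) :
    ∑ t ∈ (Fintype.piFinset fun _ : Fin p => I).filter (fun t => t b ∈ B),
      ∏ u, ∏ v ∈ Finset.Ioi u, ρ (t u) (t v) ^ L u v ≤
      n ^ ((p : ℝ) / 2) * (δ ^ κ * M ^ p) := by
  have hM0 : 0 < M := by linarith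
  have hd' : ∀ u, (0 : ℝ) < d u := fun u => by exact_mod_cast hd u
  have hsub : (Fintype.piFinset fun _ : Fin p => I).filter (fun t => t b ∈ B) ⊆
      Fintype.piFinset fun u : Fin p => if u = b then B else I := by
    intro t ht
    obtain ⟨h1, h2⟩ := Finset.mem_filter.1 ht
    rw [Fintype.mem_piFinset] at h1 ⊢
    intro u
    split_ifs with hu
    · rw [hu]
      exact h2
    · exact h1 u
  have hSI : ∀ u : Fin p, (if u = b then B else I) ⊆ I := fun u => by
    split_ifs
    · exact hBI
    · exact subset_rfl
  refine (Finset.sum_le_sum_of_subset_of_nonneg hsub fun t _ _ =>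
    Finset.prod_nonneg fun u _ => Finset.prod_nonneg fun v _ => pow_nonneg (hρ0 _ _) _).trans ?_
  have h := sum_prod_pairs_le_rpow_half hsymm hdiag hdeg hd hmono
    (fun u : Fin p => if u = b then B else I) hn hM (η := fun u => if u = b then δ else 1)
    (x := fun u => if u = b then δ ^ κ else 1) (C := fun _ _ => M) (fun _ _ => ρ)
    (fun u => by
      split_ifs
      · exact hδ
      · exact one_pos)
    (fun u => by
      split_ifs
      · exact hB
      · simpa using hI)
    (fun _ _ => hM0) (fun _ _ => hρ0)
    (fun u v _ _ t ht => by
      refine le_trans ?_ (hrow t (hSI v ht))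
      refine (Finset.sum_le_sum_of_subset_of_nonneg (hSI u) fun s _ _ =>
        pow_nonneg (hρ0 _ _) _).trans ?_
      exact Finset.sum_le_sum fun s _ => pow_le_pow_of_le_one (hρ0 _ _) (hρ1 _ _) (hdm u))
    (fun u => by
      split_ifs
      · exact (Real.rpow_pos_of_pos hδ _).le
      · exact zero_le_one)
    (fun u => by
      rw [← Real.rpow_sum_of_pos hM0, ← Finset.sum_div, ← Nat.cast_sum]
      refine mul_le_mul_of_nonneg_right ?_ (Real.rpow_pos_of_pos hM0 _).le
      split_ifs with hu
      · subst hu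
        refine Real.rpow_le_rpow_of_exponent_ge hδ hδ1 ((hκ u).trans ?_)
        rw [div_le_iff₀ (hd' u), sub_mul, one_mul, div_mul_cancel₀ _ (hd' u).ne']
        have h1 : L u a + ∑ v ∈ Finset.Ioi u, L u v ≤ d u := by
          rw [← hdeg u, ← Finset.sum_insert (by simpa using hab.le)]
          exact Finset.sum_le_sum_of_subset (Finset.subset_univ _)
        have h2 : 1 ≤ L u a := by
          rw [hsymm]
          omega
        have h3 : ((1 + ∑ v ∈ Finset.Ioi u, L u v : ℕ) : ℝ) ≤ d u := by
          exact_mod_cast (by omega)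
        push_cast at h3 ⊢
        linarith
      · simp)
  simpa using h

open Classical in
/-- Gain from restricting one edge to a set of pairs with small row sums. -/
lemma sum_prod_pairs_small_edge_le {p : ℕ} {L : Fin p → Fin p → ℕ} {d : Fin p → ℕ} {m : ℕ}
    (hsymm : ∀ u v, L u v = L v u) (hdiag : ∀ u, L u u = 0) (hdeg : ∀ u, ∑ v, L u v = d u)
    (hd : ∀ u, 0 < d u) (hdm : ∀ u, m ≤ d u) (hmono : Monotone d) {ρ : ℤ → ℤ → ℝ}
    (hρ0 : ∀ s t, 0 ≤ ρ s t) (hρ1 : ∀ s t, ρ s t ≤ 1) {I : Finset ℤ} {Q : ℤ → ℤ → Prop}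
    {n M δ κ : ℝ} (hn : 1 ≤ n) (hM : 1 ≤ M) (hI : (I.card : ℝ) ≤ n)
    (hδ : 0 < δ) (hδ1 : δ ≤ 1) (hκ : ∀ u, κ ≤ 1 / (d u : ℝ))
    (hrow : ∀ t ∈ I, ∑ s ∈ I, ρ s t ^ m ≤ M)
    (hQ : ∀ t ∈ I, ∑ s ∈ I with Q s t, ρ s t ^ m ≤ δ) {a b : Fin p} (hab : a < b)
    (hLab : L a b ≠ 0) :
    ∑ t ∈ (Fintype.piFinset fun _ : Fin p => I).filter (fun t => Q (t a) (t b)),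
      ∏ u, ∏ v ∈ Finset.Ioi u, ρ (t u) (t v) ^ L u v ≤
      n ^ ((p : ℝ) / 2) * (δ ^ κ * M ^ p) := by
  have hM0 : 0 < M := by linarith
  have hd' : ∀ u, (0 : ℝ) < d u := fun u => by exact_mod_cast hd u
  set F : Fin p → Fin p → ℤ → ℤ → ℝ := fun u v s t =>
    if u = a ∧ v = b ∧ ¬ Q s t then 0 else ρ s t with hF
  have hF0 : ∀ u v s t, 0 ≤ F u v s t := fun u v s t => by
    simp only [hF]
    split_ifs
    · exact le_rfl
    · exact hρ0 s t
  have hFρ : ∀ u v s t, F u v s t ≤ ρ s t := fun u v s t => by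
    simp only [hF]
    split_ifs
    · exact hρ0 s t
    · exact le_rfl
  have hstep : ∑ t ∈ (Fintype.piFinset fun _ : Fin p => I).filter (fun t => Q (t a) (t b)),
      ∏ u, ∏ v ∈ Finset.Ioi u, ρ (t u) (t v) ^ L u v ≤
      ∑ t ∈ Fintype.piFinset fun _ : Fin p => I,
        ∏ u, ∏ v ∈ Finset.Ioi u, F u v (t u) (t v) ^ L u v := by
    rw [Finset.sum_filter]
    refine Finset.sum_le_sum fun t _ => ?_
    split_ifs with ht
    · refine le_of_eq (Finset.prod_congr rfl fun u _ => Finset.prod_congr rfl fun v _ => ?_)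
      congr 1
      simp only [hF]
      rw [if_neg]
      rintro ⟨rfl, rfl, h⟩
      exact h ht
    · exact Finset.prod_nonneg fun u _ => Finset.prod_nonneg fun v _ => pow_nonneg (hF0 _ _ _ _) _
  refine hstep.trans ?_
  have h := sum_prod_pairs_le_rpow_half hsymm hdiag hdeg hd hmono
    (fun _ : Fin p => I) hn hM (η := fun _ => 1)
    (x := fun u => if u = a then δ ^ κ else 1)
    (C := fun u v => if u = a ∧ v = b then δ else M) F
    (fun u => one_pos) (fun u => by simpa using hI)
    (fun u v => by
      split_ifs
      · exact hδ
      · exact hM0)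
    hF0
    (fun u v _ _ t ht => by
      by_cases huv : u = a ∧ v = b
      · obtain ⟨rfl, rfl⟩ := huv
        simp only [and_self, if_true]
        refine le_trans ?_ (hQ t ht)
        rw [Finset.sum_filter]
        refine Finset.sum_le_sum fun s _ => ?_
        split_ifs with hq
        · exact (pow_le_pow_left₀ (hF0 _ _ _ _) (hFρ _ _ _ _) _).trans
            (pow_le_pow_of_le_one (hρ0 _ _) (hρ1 _ _) (hdm u))
        · simp [hF, hq, (hd u).ne']
      · rw [if_neg huv]
        refine le_trans (Finset.sum_le_sum fun s _ => ?_) (hrow t ht)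
        exact (pow_le_pow_left₀ (hF0 _ _ _ _) (hFρ _ _ _ _) _).trans
            (pow_le_pow_of_le_one (hρ0 _ _) (hρ1 _ _) (hdm u)))
    (fun u => by
      split_ifs
      · exact (Real.rpow_pos_of_pos hδ _).le
      · exact zero_le_one)
    (fun u => by
      rw [Real.one_rpow, one_mul, Nat.cast_sum, Finset.sum_div, Real.rpow_sum_of_pos hM0]
      by_cases hu : u = a
      · subst hu
        have hx : δ ^ κ = ∏ v ∈ Finset.Ioi u, if v = b then δ ^ κ else 1 := by
          rw [Finset.prod_ite_eq', if_pos (Finset.mem_Ioi.2 hab)]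
        rw [if_pos rfl]
        nth_rewrite 1 [hx]
        rw [← Finset.prod_mul_distrib]
        refine Finset.prod_le_prod (fun v _ => ?_) fun v _ => ?_
        · split_ifs
          · exact (Real.rpow_pos_of_pos hδ _).le
          · exact (Real.rpow_pos_of_pos hM0 _).le
        · by_cases hv : v = b
          · subst hv
            simp only [and_self, if_true]
            refine le_trans (Real.rpow_le_rpow_of_exponent_ge hδ hδ1 ((hκ u).trans ?_))
              (le_mul_of_one_le_right (Real.rpow_pos_of_pos hδ _).le
                (Real.one_le_rpow hM (by positivity)))
            refine div_le_div_of_nonneg_right ?_ (hd' u).le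
            exact_mod_cast Nat.one_le_iff_ne_zero.2 hLab
          · simp [hv]
      · simp [hu])
  simpa using h

open Classical in
/-- The sum over all configurations of the products of covariances is at most the number of
configurations with only short edges plus a remainder controlled by the far covariances. -/
lemma sum_prod_pairs_le_near_add {p : ℕ} {L : Fin p → Fin p → ℕ} {d : Fin p → ℕ} {m : ℕ}
    (hsymm : ∀ u v, L u v = L v u) (hdiag : ∀ u, L u u = 0) (hdeg : ∀ u, ∑ v, L u v = d u)
    (hd : ∀ u, 0 < d u) (hdm : ∀ u, m ≤ d u) (hmono : Monotone d) {ρ : ℤ → ℤ → ℝ}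
    (hρ0 : ∀ s t, 0 ≤ ρ s t) (hρ1 : ∀ s t, ρ s t ≤ 1) {I : Finset ℤ} {n M δ κ : ℝ} {K : ℕ}
    (hn : 1 ≤ n) (hM : 1 ≤ M) (hI : (I.card : ℝ) ≤ n)
    (hδ : 0 < δ) (hδ1 : δ ≤ 1) (hκ : ∀ u, κ ≤ 1 / (d u : ℝ))
    (hrow : ∀ t ∈ I, ∑ s ∈ I, ρ s t ^ m ≤ M)
    (hfar : ∑ jk ∈ (I ×ˢ I).filter (fun jk => (K : ℤ) < |jk.1 - jk.2|), ρ jk.1 jk.2 ^ m ≤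
      n * δ ^ 2) :
    ∑ t ∈ Fintype.piFinset fun _ : Fin p => I, ∏ u, ∏ v ∈ Finset.Ioi u, ρ (t u) (t v) ^ L u v ≤
      ((Fintype.piFinset fun _ : Fin p => I).filter
        fun t => ∀ u v, L u v ≠ 0 → |t u - t v| ≤ (K : ℤ)).card +
      p * p * (2 * (n ^ ((p : ℝ) / 2) * (δ ^ κ * M ^ p))) := by
  set far : ℤ → ℝ := fun k => ∑ j ∈ I with (K : ℤ) < |j - k|, ρ j k ^ m with hfardef
  set B : Finset ℤ := I.filter fun k => δ < far k with hBdef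
  set S := Fintype.piFinset fun _ : Fin p => I with hS
  set W : (Fin p → ℤ) → ℝ := fun t => ∏ u, ∏ v ∈ Finset.Ioi u, ρ (t u) (t v) ^ L u v with hW
  obtain ⟨Q, hQdef⟩ : ∃ Q : ℤ → ℤ → Prop, ∀ s t, Q s t ↔ (K : ℤ) < |s - t| ∧ t ∉ B :=
    ⟨_, fun _ _ => Iff.rfl⟩
  have hW0 : ∀ t, 0 ≤ W t := fun t =>
    Finset.prod_nonneg fun u _ => Finset.prod_nonneg fun v _ => pow_nonneg (hρ0 _ _) _
  have hW1 : ∀ t, W t ≤ 1 := fun t =>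
    Finset.prod_le_one (fun u _ => Finset.prod_nonneg fun v _ => pow_nonneg (hρ0 _ _) _)
      fun u _ => Finset.prod_le_one (fun v _ => pow_nonneg (hρ0 _ _) _)
        fun v _ => pow_le_one₀ (hρ0 _ _) (hρ1 _ _)
  have hfar0 : ∀ k, 0 ≤ far k := fun k => Finset.sum_nonneg fun j _ => pow_nonneg (hρ0 _ _) _
  have hfarsum : ∑ k ∈ I, far k ≤ n * δ ^ 2 := by
    refine le_trans (le_of_eq ?_) hfar
    rw [Finset.sum_filter, Finset.sum_product_right]
    exact Finset.sum_congr rfl fun k _ => Finset.sum_filter _ _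
  have hBcard : (B.card : ℝ) ≤ n * δ := by
    have h1 : (B.card : ℝ) * δ ≤ n * δ ^ 2 := by
      calc (B.card : ℝ) * δ = ∑ k ∈ B, δ := by simp
        _ ≤ ∑ k ∈ B, far k :=
            Finset.sum_le_sum fun k hk => (Finset.mem_filter.1 hk).2.le
        _ ≤ ∑ k ∈ I, far k :=
            Finset.sum_le_sum_of_subset_of_nonneg (Finset.filter_subset _ _) fun k _ _ => hfar0 k
        _ ≤ _ := hfarsum
    have h2 : (B.card : ℝ) * δ ≤ (n * δ) * δ := by
      rw [mul_assoc, ← sq]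
      exact h1
    exact le_of_mul_le_mul_right h2 hδ
  have hQ : ∀ t ∈ I, ∑ s ∈ I with Q s t, ρ s t ^ m ≤ δ := by
    intro t ht
    by_cases htB : t ∈ B
    · rw [Finset.sum_eq_zero fun s hs => absurd htB ((hQdef _ _).1 (Finset.mem_filter.1 hs).2).2]
      exact hδ.le
    · have h1 : far t ≤ δ := by
        by_contra h
        exact htB (Finset.mem_filter.2 ⟨ht, not_le.1 h⟩)
      refine le_trans (Finset.sum_le_sum_of_subset_of_nonneg (fun s hs => ?_)
        fun s _ _ => pow_nonneg (hρ0 _ _) _) h1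
      obtain ⟨h2, h3⟩ := Finset.mem_filter.1 hs
      exact Finset.mem_filter.2 ⟨h2, ((hQdef _ _).1 h3).1⟩
  have hC0 : 0 ≤ n ^ ((p : ℝ) / 2) * (δ ^ κ * M ^ p) := by positivity
  have hsite : ∀ a b, a < b → L a b ≠ 0 → ∑ t ∈ S.filter (fun t => t b ∈ B), W t ≤
      n ^ ((p : ℝ) / 2) * (δ ^ κ * M ^ p) := fun a b hab hL =>
    sum_prod_pairs_small_site_le hsymm hdiag hdeg hd hdm hmono hρ0 hρ1 hn hM hI
      (Finset.filter_subset _ _) hBcard hδ hδ1 hκ hrow hab hL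
  have hedge : ∀ a b, a < b → L a b ≠ 0 → ∑ t ∈ S.filter (fun t => Q (t a) (t b)), W t ≤
      n ^ ((p : ℝ) / 2) * (δ ^ κ * M ^ p) := fun a b hab hL =>
    sum_prod_pairs_small_edge_le (Q := Q) hsymm hdiag hdeg hd hdm hmono hρ0 hρ1 hn hM hI
      hδ hδ1 hκ hrow hQ hab hL
  set G : Fin p → Fin p → (Fin p → ℤ) → ℝ := fun a b t =>
    if a < b ∧ L a b ≠ 0 then
      (if t b ∈ B then W t else 0) + (if Q (t a) (t b) then W t else 0) else 0 with hG
  have hG0 : ∀ a b t, 0 ≤ G a b t := by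
    intro a b t
    have := hW0 t
    simp only [hG]
    split_ifs <;> linarith
  have hpt : ∀ t, W t ≤ (if ∀ u v, L u v ≠ 0 → |t u - t v| ≤ (K : ℤ) then 1 else 0) +
      ∑ a, ∑ b, G a b t := by
    intro t
    have hGG : 0 ≤ ∑ a, ∑ b, G a b t :=
      Finset.sum_nonneg fun a _ => Finset.sum_nonneg fun b _ => hG0 a b t
    by_cases hnear : ∀ u v, L u v ≠ 0 → |t u - t v| ≤ (K : ℤ)
    · rw [if_pos hnear]
      linarith [hW1 t]
    · rw [if_neg hnear, zero_add]
      push Not at hnear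
      obtain ⟨u, v, huv, hK⟩ := hnear
      obtain ⟨a, b, hab, hL, hK'⟩ : ∃ a b, a < b ∧ L a b ≠ 0 ∧ (K : ℤ) < |t a - t b| := by
        rcases lt_trichotomy u v with h | h | h
        · exact ⟨u, v, h, huv, hK⟩
        · subst h
          exact absurd (hdiag u) huv
        · exact ⟨v, u, h, by rwa [hsymm], by rwa [abs_sub_comm]⟩
      calc W t ≤ G a b t := by
            have := hW0 t
            simp only [hG, if_pos (And.intro hab hL)]
            by_cases hb : t b ∈ B
            · rw [if_pos hb]
              split_ifs <;> linarith
            · have hq : Q (t a) (t b) := (hQdef _ _).2 ⟨hK', hb⟩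
              rw [if_neg hb, if_pos hq, zero_add]
        _ ≤ ∑ b, G a b t :=
            Finset.single_le_sum (f := fun b => G a b t) (fun b _ => hG0 a b t)
              (Finset.mem_univ b)
        _ ≤ ∑ a, ∑ b, G a b t :=
            Finset.single_le_sum (f := fun a => ∑ b, G a b t)
              (fun a _ => Finset.sum_nonneg fun b _ => hG0 a b t) (Finset.mem_univ a)
  have hGsum : ∀ a b, ∑ t ∈ S, G a b t ≤ 2 * (n ^ ((p : ℝ) / 2) * (δ ^ κ * M ^ p)) := by
    intro a b
    by_cases h : a < b ∧ L a b ≠ 0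
    · simp only [hG, if_pos h]
      rw [Finset.sum_add_distrib, ← Finset.sum_filter, ← Finset.sum_filter]
      linarith [hsite a b h.1 h.2, hedge a b h.1 h.2]
    · simp only [hG, if_neg h, Finset.sum_const_zero]
      linarith
  calc ∑ t ∈ S, W t
      ≤ ∑ t ∈ S, ((if ∀ u v, L u v ≠ 0 → |t u - t v| ≤ (K : ℤ) then 1 else 0) +
          ∑ a, ∑ b, G a b t) := Finset.sum_le_sum fun t _ => hpt t
    _ = (S.filter fun t => ∀ u v, L u v ≠ 0 → |t u - t v| ≤ (K : ℤ)).card +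
          ∑ a, ∑ b, ∑ t ∈ S, G a b t := by
        rw [Finset.sum_add_distrib, Finset.sum_boole, Finset.sum_comm]
        congr 1
        exact Finset.sum_congr rfl fun a _ => Finset.sum_comm
    _ ≤ _ := by
        gcongr
        calc ∑ a, ∑ b, ∑ t ∈ S, G a b t
            ≤ ∑ a : Fin p, ∑ b : Fin p, 2 * (n ^ ((p : ℝ) / 2) * (δ ^ κ * M ^ p)) :=
              Finset.sum_le_sum fun a _ => Finset.sum_le_sum fun b _ => hGsum a b
          _ = _ := by simp [mul_assoc]

lemma tendsto_sum_prod_pairs_of_monotone {p : ℕ} (hp : 3 ≤ p) {L : Fin p → Fin p → ℕ}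
    {d : Fin p → ℕ} {m : ℕ}
    (hsymm : ∀ u v, L u v = L v u) (hdiag : ∀ u, L u u = 0) (hdeg : ∀ u, ∑ v, L u v = d u)
    (hd : ∀ u, 0 < d u) (hdm : ∀ u, m ≤ d u) (hmono : Monotone d)
    (hconn : ∀ A : Finset (Fin p), A.Nonempty → (∀ u v, L u v ≠ 0 → (u ∈ A ↔ v ∈ A)) →
      A = Finset.univ) {ρ : ℕ → ℤ → ℤ → ℝ}
    (hρ0 : ∀ n s t, 0 ≤ ρ n s t) (hρ1 : ∀ n s t, ρ n s t ≤ 1) {M : ℝ} (hM : 1 ≤ M)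
    (hrow : ∀ n : ℕ, ∀ t ∈ Finset.Icc (1 : ℤ) n, ∑ s ∈ Finset.Icc (1 : ℤ) n, ρ n s t ^ m ≤ M)
    (hfar : ∀ δ : ℝ, 0 < δ → ∃ K : ℕ, ∀ n : ℕ, 1 ≤ n →
      ∑ jk ∈ (Finset.Icc (1 : ℤ) n ×ˢ Finset.Icc (1 : ℤ) n).filter
        (fun jk => (K : ℤ) < |jk.1 - jk.2|), ρ n jk.1 jk.2 ^ m ≤ n * δ) :
    Tendsto (fun n : ℕ => (∑ t ∈ Fintype.piFinset fun _ : Fin p => Finset.Icc (1 : ℤ) n,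
      ∏ u, ∏ v ∈ Finset.Ioi u, ρ n (t u) (t v) ^ L u v) / (n : ℝ) ^ ((p : ℝ) / 2))
      atTop (𝓝 0) := by
  classical
  have hp0 : 0 < p := by omega
  set κ : ℝ := 1 / ((∑ u, d u : ℕ) : ℝ) with hκdef
  have hdu : ∀ u, d u ≤ ∑ u, d u := fun u =>
    Finset.single_le_sum (f := d) (fun _ _ => Nat.zero_le _) (Finset.mem_univ u)
  have hκ0 : 0 < κ := by
    have : 0 < ∑ u, d u := (hd ⟨0, hp0⟩).trans_le (hdu _)
    positivity
  have hκ : ∀ u, κ ≤ 1 / (d u : ℝ) := fun u =>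
    one_div_le_one_div_of_le (by exact_mod_cast hd u) (by exact_mod_cast hdu u)
  refine Metric.tendsto_atTop.2 fun ε hε => ?_
  obtain ⟨δ, hδ, hδ1, hδε⟩ : ∃ δ : ℝ, 0 < δ ∧ δ ≤ 1 ∧
      p * p * (2 * (δ ^ κ * M ^ p)) < ε / 2 := by
    have h1 : Tendsto (fun δ : ℝ => p * p * (2 * (δ ^ κ * M ^ p))) (𝓝[>] 0) (𝓝 0) := by
      have h2 : Tendsto (fun δ : ℝ => δ ^ κ) (𝓝[>] 0) (𝓝 0) := by
        have := (Real.continuousAt_rpow_const 0 κ (Or.inr hκ0.le)).tendsto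
        rw [Real.zero_rpow hκ0.ne'] at this
        exact this.mono_left nhdsWithin_le_nhds
      simpa using ((h2.mul_const (M ^ p)).const_mul 2).const_mul ((p : ℝ) * p)
    obtain ⟨δ, h3, h4⟩ := ((h1.eventually (gt_mem_nhds (half_pos hε))).and
      (Ioc_mem_nhdsGT (zero_lt_one' ℝ))).exists
    exact ⟨δ, h4.1, h4.2, h3⟩
  obtain ⟨K, hK⟩ := hfar (δ ^ 2) (by positivity)
  obtain ⟨c, hc⟩ := exists_card_near_le hp0 hconn K
  have hlim : Tendsto (fun n : ℕ => (c : ℝ) * (n : ℝ) ^ (-((p : ℝ) / 2 - 1))) atTop (𝓝 0) := by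
    have hp3 : (3 : ℝ) ≤ p := by exact_mod_cast hp
    have := ((tendsto_rpow_neg_atTop (y := (p : ℝ) / 2 - 1) (by linarith)).comp
      tendsto_natCast_atTop_atTop).const_mul (c : ℝ)
    simpa using this
  obtain ⟨N, hN⟩ := Filter.eventually_atTop.1 (hlim.eventually (gt_mem_nhds (half_pos hε)))
  refine ⟨max N 1, fun n hn => ?_⟩
  have hn1 : 1 ≤ n := (le_max_right _ _).trans hn
  have hn1' : (1 : ℝ) ≤ n := by exact_mod_cast hn1
  have hn0 : (0 : ℝ) < n := by linarith
  have hpow : 0 < (n : ℝ) ^ ((p : ℝ) / 2) := Real.rpow_pos_of_pos hn0 _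
  have hcard : (Finset.Icc (1 : ℤ) n).card = n := by simp
  have hbound := sum_prod_pairs_le_near_add (M := M) (K := K) hsymm hdiag hdeg hd hdm hmono
    (hρ0 n) (hρ1 n) hn1' hM (by rw [hcard]) hδ hδ1 hκ (hrow n) (hK n hn1)
  have hnear := hc (Finset.Icc (1 : ℤ) n)
  rw [hcard] at hnear
  have hnear' := (Nat.cast_le (α := ℝ)).2 hnear
  rw [Nat.cast_mul] at hnear'
  have hsum0 : 0 ≤ ∑ t ∈ Fintype.piFinset fun _ : Fin p => Finset.Icc (1 : ℤ) n,
      ∏ u, ∏ v ∈ Finset.Ioi u, ρ n (t u) (t v) ^ L u v :=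
    Finset.sum_nonneg fun t _ => Finset.prod_nonneg fun u _ => Finset.prod_nonneg fun v _ =>
      pow_nonneg (hρ0 _ _ _) _
  rw [Real.dist_eq, sub_zero, abs_of_nonneg (div_nonneg hsum0 hpow.le), div_lt_iff₀ hpow]
  have hlin : (n : ℝ) * c = c * (n : ℝ) ^ (-((p : ℝ) / 2 - 1)) * (n : ℝ) ^ ((p : ℝ) / 2) := by
    rw [mul_assoc, ← Real.rpow_add hn0, mul_comm]
    congr 1
    rw [show -((p : ℝ) / 2 - 1) + (p : ℝ) / 2 = 1 by ring, Real.rpow_one]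
  have h1 := mul_lt_mul_of_pos_right (hN n ((le_max_left _ _).trans hn)) hpow
  have h2 := mul_lt_mul_of_pos_right hδε hpow
  rw [← hlin] at h1
  nlinarith [hbound, hnear', h1, h2]

lemma prod_pairs_symmetrize {α : Type*} {p : ℕ} {ρ : α → α → ℝ} (hsymm : ∀ s t, ρ s t = ρ t s)
    {l : Fin p → Fin p → ℕ} (hl : ∀ u, l u u = 0) (t : Fin p → α) :
    ∏ u, ∏ v, ρ (t u) (t v) ^ l u v =
      ∏ u, ∏ v ∈ Finset.Ioi u, ρ (t u) (t v) ^ (l u v + l v u) := by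
  have h := Finset.prod_prod_Ioi_mul_eq_prod_prod_off_diag
    fun v u => ρ (t u) (t v) ^ l u v
  calc _ = ∏ u, ∏ v ∈ {u}ᶜ, ρ (t u) (t v) ^ l u v := by
        refine Finset.prod_congr rfl fun u _ => (Finset.prod_subset (Finset.subset_univ _)
          fun v _ hv => ?_).symm
        have : v = u := by simpa using hv
        rw [this, hl, pow_zero]
    _ = _ := by
        rw [← h]
        refine Finset.prod_congr rfl fun u _ => Finset.prod_congr rfl fun v _ => ?_
        rw [hsymm (t v) (t u), pow_add]

/-- Diagram sums over a connected multigraph without loops and with all degrees at least `m` are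
of smaller order than `n ^ (p / 2)`. -/
theorem tendsto_sum_prod_pairs {p : ℕ} (hp : 3 ≤ p) {l : Fin p → Fin p → ℕ} {m : ℕ} (hm : 1 ≤ m)
    (hdiag : ∀ u, l u u = 0) (hdeg : ∀ u, m ≤ ∑ v, (l u v + l v u))
    (hconn : ∀ A : Finset (Fin p), A.Nonempty → (∀ u v, l u v ≠ 0 → (u ∈ A ↔ v ∈ A)) →
      A = Finset.univ) {ρ : ℕ → ℤ → ℤ → ℝ} (hρsymm : ∀ n s t, ρ n s t = ρ n t s)
    (hρ0 : ∀ n s t, 0 ≤ ρ n s t) (hρ1 : ∀ n s t, ρ n s t ≤ 1) {M : ℝ} (hM : 1 ≤ M)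
    (hrow : ∀ n : ℕ, ∀ t ∈ Finset.Icc (1 : ℤ) n, ∑ s ∈ Finset.Icc (1 : ℤ) n, ρ n s t ^ m ≤ M)
    (hfar : ∀ δ : ℝ, 0 < δ → ∃ K : ℕ, ∀ n : ℕ, 1 ≤ n →
      ∑ jk ∈ (Finset.Icc (1 : ℤ) n ×ˢ Finset.Icc (1 : ℤ) n).filter
        (fun jk => (K : ℤ) < |jk.1 - jk.2|), ρ n jk.1 jk.2 ^ m ≤ n * δ) :
    Tendsto (fun n : ℕ => (∑ t ∈ Fintype.piFinset fun _ : Fin p => Finset.Icc (1 : ℤ) n,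
      ∏ u, ∏ v, ρ n (t u) (t v) ^ l u v) / (n : ℝ) ^ ((p : ℝ) / 2)) atTop (𝓝 0) := by
  set d : Fin p → ℕ := fun u => ∑ v, (l u v + l v u) with hd
  set σ := Tuple.sort d with hσ
  set L : Fin p → Fin p → ℕ := fun u v => l (σ u) (σ v) + l (σ v) (σ u) with hL
  have key := tendsto_sum_prod_pairs_of_monotone hp (L := L) (d := d ∘ σ) (m := m) (ρ := ρ)
    (fun u v => add_comm _ _) (fun u => by simp [hL, hdiag])
    (fun u => Equiv.sum_comp σ fun v => l (σ u) v + l v (σ u))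
    (fun u => hm.trans (hdeg _)) (fun u => hdeg _) (Tuple.monotone_sort d)
    (fun A hA h => by
      have h1 := hconn (A.map σ.toEmbedding) (hA.map) fun u v huv => by
        have h2 : L (σ.symm u) (σ.symm v) ≠ 0 := by
          simp only [hL, Equiv.apply_symm_apply]
          omega
        simpa [Finset.mem_map_equiv] using h _ _ h2
      ext u
      have h3 := Finset.mem_univ (σ u)
      rw [← h1] at h3
      simpa using h3)
    hρ0 hρ1 hM hrow hfar
  refine key.congr fun n => ?_
  congr 1
  refine (Finset.sum_nbij' (fun t => t ∘ σ) (fun t => t ∘ σ.symm) ?_ ?_ ?_ ?_ ?_).symm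
  · intro t ht
    rw [Fintype.mem_piFinset] at ht ⊢
    exact fun u => ht _
  · intro t ht
    rw [Fintype.mem_piFinset] at ht ⊢
    exact fun u => ht _
  · intro t _
    ext u
    simp
  · intro t _
    ext u
    simp
  · intro t _
    have h := prod_pairs_symmetrize (hρsymm n) (l := fun u v => l (σ u) (σ v))
      (fun u => hdiag _) (t ∘ σ)
    rw [← h, ← Equiv.prod_comp σ]
    refine Finset.prod_congr rfl fun u _ => ?_
    rw [← Equiv.prod_comp σ]
    rfl

/-- The number of edges of the diagram `l` from row `u` to row `v`. -/
def rowMultiplicity {p : ℕ} {κ : Type*} [Fintype κ] (l : (Fin p × κ) × (Fin p × κ) →₀ ℕ)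
    (u v : Fin p) : ℕ :=
  ∑ i, ∑ j, l ((u, i), (v, j))

section rowMultiplicity

variable {p : ℕ} {κ : Type*} [Fintype κ] {l : (Fin p × κ) × (Fin p × κ) →₀ ℕ}

lemma rowMultiplicity_ne_zero {e : (Fin p × κ) × (Fin p × κ)} (he : l e ≠ 0) :
    rowMultiplicity l e.1.1 e.2.1 ≠ 0 := by
  intro h
  rw [rowMultiplicity, Finset.sum_eq_zero_iff] at h
  exact he (Finset.sum_eq_zero_iff.1 (h e.1.2 (Finset.mem_univ _)) e.2.2 (Finset.mem_univ _))

lemma rowMultiplicity_self (hl : ∀ e, l e ≠ 0 → e.1.1 ≠ e.2.1) (u : Fin p) :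
    rowMultiplicity l u u = 0 :=
  Finset.sum_eq_zero fun i _ => Finset.sum_eq_zero fun j _ => by
    by_contra h
    exact hl ((u, i), (u, j)) h rfl

lemma sum_rowMultiplicity {k : Fin p → κ → ℕ}
    (hl : ∀ c, ∑ d, (l (c, d) + l (d, c)) = k c.1 c.2) (u : Fin p) :
    ∑ v, (rowMultiplicity l u v + rowMultiplicity l v u) = ∑ i, k u i := by
  calc _ = ∑ v, ∑ i, ∑ j, (l ((u, i), (v, j)) + l ((v, j), (u, i))) := by
        refine Finset.sum_congr rfl fun v _ => ?_
        simp only [rowMultiplicity, Finset.sum_add_distrib]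
        rw [add_right_inj]
        exact Finset.sum_comm
    _ = ∑ i, ∑ v, ∑ j, (l ((u, i), (v, j)) + l ((v, j), (u, i))) := Finset.sum_comm
    _ = _ := by
        refine Finset.sum_congr rfl fun i _ => ?_
        rw [← hl (u, i), Fintype.sum_prod_type]

lemma prod_abs_pow_le_prod_rows {S : (Fin p × κ) × (Fin p × κ) → ℝ} {R : Fin p → Fin p → ℝ}
    (hS : ∀ e, |S e| ≤ R e.1.1 e.2.1) :
    ∏ e, |S e| ^ l e ≤ ∏ u, ∏ v, R u v ^ rowMultiplicity l u v := by
  calc ∏ e, |S e| ^ l e ≤ ∏ e : (Fin p × κ) × (Fin p × κ), R e.1.1 e.2.1 ^ l e :=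
        Finset.prod_le_prod (fun e _ => pow_nonneg (abs_nonneg _) _)
          fun e _ => pow_le_pow_left₀ (abs_nonneg _) (hS e) _
    _ = _ := by
        simp only [Fintype.prod_prod_type, rowMultiplicity]
        refine Finset.prod_congr rfl fun u _ => ?_
        rw [Finset.prod_comm]
        refine Finset.prod_congr rfl fun v _ => ?_
        simp only [Finset.prod_pow_eq_pow_sum]

end rowMultiplicity

lemma abs_integral_mul_le_one {Ω : Type*} [MeasurableSpace Ω] {P : Measure Ω} {Y Z : Ω → ℝ}
    (hY : ∫ ω, Y ω * Y ω ∂P = 1) (hZ : ∫ ω, Z ω * Z ω ∂P = 1) : |∫ ω, Y ω * Z ω ∂P| ≤ 1 := by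
  have hYi : Integrable (fun ω => Y ω * Y ω) P := by
    by_contra h
    simp [integral_undef h] at hY
  have hZi : Integrable (fun ω => Z ω * Z ω) P := by
    by_contra h
    simp [integral_undef h] at hZ
  have h := norm_integral_le_of_norm_le (f := fun ω => Y ω * Z ω) ((hYi.add hZi).div_const 2)
    (Eventually.of_forall fun ω => by
      rw [Real.norm_eq_abs, abs_le]
      simp only [Pi.add_apply]
      constructor <;> nlinarith [sq_nonneg (Y ω - Z ω), sq_nonneg (Y ω + Z ω)])
  rw [integral_div] at h
  simp only [Pi.add_apply] at h
  rw [integral_add hYi hZi, hY, hZ] at h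
  simpa using h

lemma IsJointGaussian.hasGaussianLaw_comp {Ω ι κ : Type*} [MeasurableSpace Ω] {P : Measure Ω}
    [Fintype ι] [Fintype κ] {X : ι → Ω → ℝ} (h : IsJointGaussian P X)
    (hX : ∀ i, Measurable (X i)) (f : κ → ι) : HasGaussianLaw (fun ω a => X (f a) ω) P :=
  (h.hasGaussianLaw hX).map_fun
    (ContinuousLinearMap.pi fun a => ContinuousLinearMap.proj (R := ℝ) (φ := fun _ : ι => ℝ) (f a))

/-- (3.23) in the proof of Theorem 1 of Bardet–Surgailis: joint
cumulants of Hermite polynomials of a triangular Gaussian array are `o(n^{p/2})`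
under (3.1) and (3.2). -/
theorem cumulant_sum_little_o
    (ν m : ℕ) (hν : 1 ≤ ν) (hm : 1 ≤ m)
    (Ω : ℕ → Type) (ms : ∀ n, MeasurableSpace (Ω n)) (P : ∀ n, Measure (Ω n))
    (hP : ∀ n, IsProbabilityMeasure (P n))
    (X : (n : ℕ) → ℤ → Fin ν → Ω n → ℝ)
    (hmeas : ∀ n k u, Measurable (X n k u))
    (hG : ∀ n : ℕ, IsJointGaussian (P n)
      (fun ku : (Finset.Icc (1 : ℤ) (n : ℤ)) × Fin ν => X n (ku.1 : ℤ) ku.2))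
    (hcent : ∀ (n : ℕ), ∀ k ∈ Finset.Icc (1 : ℤ) (n : ℤ), ∀ u,
      ∫ ω, X n k u ω ∂(P n) = 0)
    (hstd : ∀ (n : ℕ), ∀ k ∈ Finset.Icc (1 : ℤ) (n : ℤ), ∀ u v,
      ∫ ω, X n k u ω * X n k v ω ∂(P n) = if u = v then 1 else 0)
    -- condition (3.1)
    (hcov : ∃ M : ℝ, ∀ (u v : Fin ν) (n : ℕ), ∀ k ∈ Finset.Icc (1 : ℤ) (n : ℤ),
      ∑ j ∈ Finset.Icc (1 : ℤ) (n : ℤ),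
        |∫ ω, X n j u ω * X n k v ω ∂(P n)| ^ m ≤ M)
    -- condition (3.2)
    (hcov2 : ∀ δ : ℝ, 0 < δ → ∃ K : ℕ, ∀ (u v : Fin ν) (n : ℕ), 1 ≤ n →
      (n : ℝ)⁻¹ * ∑ jk ∈ (Finset.Icc (1 : ℤ) (n : ℤ) ×ˢ Finset.Icc (1 : ℤ) (n : ℤ)).filter
          (fun jk => (K : ℤ) < |jk.1 - jk.2|),
        |∫ ω, X n jk.1 u ω * X n jk.2 v ω ∂(P n)| ^ m ≤ δ) :
    ∀ p : ℕ, 3 ≤ p → ∀ k : Fin p → Fin ν → ℕ, (∀ u : Fin p, m ≤ ∑ i, k u i) →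
      Tendsto (fun n : ℕ =>
          (∑ t ∈ Fintype.piFinset (fun _ : Fin p => Finset.Icc (1 : ℤ) (n : ℤ)),
            |jointCumulant (P n)
              (fun u : Fin p => fun ω => hermiteProd (k u) (fun i => X n (t u) i ω))|)
            / (n : ℝ) ^ ((p : ℝ) / 2)) atTop (𝓝 0) := by
  intro p hp k hk
  have : Nonempty (Fin ν) := ⟨⟨0, hν⟩⟩
  set I : ℕ → Finset ℤ := fun n => Finset.Icc (1 : ℤ) n with hI
  set r : ℕ → ℤ → ℤ → Fin ν × Fin ν → ℝ := fun n s t e =>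
    |∫ ω, X n s e.1 ω * X n t e.2 ω ∂(P n)| with hr
  set ρ : ℕ → ℤ → ℤ → ℝ := fun n s t => if s ∈ I n ∧ t ∈ I n then ⨆ e, r n s t e else 0 with hρ
  have hr0 : ∀ n s t e, 0 ≤ r n s t e := fun n s t e => abs_nonneg _
  have hr1 : ∀ n, ∀ s ∈ I n, ∀ t ∈ I n, ∀ e, r n s t e ≤ 1 := fun n s hs t ht e =>
    abs_integral_mul_le_one (by rw [hstd n s hs, if_pos rfl]) (by rw [hstd n t ht, if_pos rfl])
  have hrρ : ∀ n, ∀ s ∈ I n, ∀ t ∈ I n, ∀ e, r n s t e ≤ ρ n s t := fun n s hs t ht e => by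
    simp only [hρ, if_pos (And.intro hs ht)]
    exact le_ciSup (f := fun e => r n s t e) (Set.finite_range _).bddAbove e
  have hρ0 : ∀ n s t, 0 ≤ ρ n s t := fun n s t => by
    simp only [hρ]
    split_ifs
    · exact Real.iSup_nonneg (hr0 n s t)
    · exact le_rfl
  have hρ1 : ∀ n s t, ρ n s t ≤ 1 := fun n s t => by
    simp only [hρ]
    split_ifs with h
    · exact Real.iSup_le (hr1 n s h.1 t h.2) zero_le_one
    · exact zero_le_one
  have hρsymm : ∀ n s t, ρ n s t = ρ n t s := fun n s t => by
    have h : ⨆ e, r n s t e = ⨆ e, r n t s e := by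
      rw [← Equiv.iSup_comp (Equiv.prodComm (Fin ν) (Fin ν))]
      simp only [hr, Equiv.prodComm_apply, Prod.fst_swap, Prod.snd_swap, mul_comm]
    simp only [hρ, h, and_comm]
  have hρm : ∀ n s t, ρ n s t ^ m ≤ ∑ e, r n s t e ^ m := fun n s t => by
    have h0 : ∀ e ∈ Finset.univ, 0 ≤ r n s t e ^ m := fun e _ => pow_nonneg (hr0 n s t e) m
    simp only [hρ]
    split_ifs with h
    · obtain ⟨e, he⟩ := exists_eq_ciSup_of_finite (f := fun e => r n s t e)
      rw [← he]
      exact Finset.single_le_sum h0 (Finset.mem_univ e)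
    · rw [zero_pow (by omega)]
      exact Finset.sum_nonneg h0
  have hνpos : (0 : ℝ) < (ν : ℝ) * ν := by
    have : (0 : ℝ) < ν := by exact_mod_cast hν
    positivity
  obtain ⟨M₀, hM₀⟩ := hcov
  set M : ℝ := max 1 (ν * ν * M₀) with hM
  have hrow : ∀ n : ℕ, ∀ t ∈ I n, ∑ s ∈ I n, ρ n s t ^ m ≤ M := fun n t ht => by
    calc _ ≤ ∑ s ∈ I n, ∑ e, r n s t e ^ m := Finset.sum_le_sum fun s _ => hρm n s t
      _ = ∑ e, ∑ s ∈ I n, r n s t e ^ m := Finset.sum_comm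
      _ ≤ ∑ e : Fin ν × Fin ν, M₀ := Finset.sum_le_sum fun e _ => hM₀ e.1 e.2 n t ht
      _ = ν * ν * M₀ := by simp
      _ ≤ M := le_max_right _ _
  have hfar : ∀ δ : ℝ, 0 < δ → ∃ K : ℕ, ∀ n : ℕ, 1 ≤ n →
      ∑ jk ∈ (I n ×ˢ I n).filter (fun jk => (K : ℤ) < |jk.1 - jk.2|),
        ρ n jk.1 jk.2 ^ m ≤ n * δ := fun δ hδ => by
    obtain ⟨K, hK⟩ := hcov2 (δ / (ν * ν)) (by positivity)
    refine ⟨K, fun n hn => ?_⟩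
    have hn0 : (0 : ℝ) < n := by exact_mod_cast hn
    calc _ ≤ ∑ jk ∈ (I n ×ˢ I n).filter (fun jk => (K : ℤ) < |jk.1 - jk.2|),
          ∑ e, r n jk.1 jk.2 e ^ m := Finset.sum_le_sum fun jk _ => hρm n jk.1 jk.2
      _ = ∑ e, ∑ jk ∈ (I n ×ˢ I n).filter (fun jk => (K : ℤ) < |jk.1 - jk.2|),
          r n jk.1 jk.2 e ^ m := Finset.sum_comm
      _ ≤ ∑ e : Fin ν × Fin ν, n * (δ / (ν * ν)) := Finset.sum_le_sum fun e _ => by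
          have := hK e.1 e.2 n hn
          rwa [inv_mul_le_iff₀ hn0] at this
      _ = n * δ := by
          simp only [Finset.sum_const, Finset.card_univ, Fintype.card_prod, Fintype.card_fin,
            nsmul_eq_mul, Nat.cast_mul]
          field_simp
  obtain ⟨D, C, hD, hbound⟩ := exists_cumulant_bound k
  set T : (((Fin p × Fin ν) × (Fin p × Fin ν)) →₀ ℕ) → ℕ → ℝ := fun l n =>
    ∑ t ∈ Fintype.piFinset fun _ : Fin p => I n,
      ∏ u, ∏ v, ρ n (t u) (t v) ^ rowMultiplicity l u v with hT
  have hlim : Tendsto (fun n : ℕ => ∑ l ∈ D, C l * (T l n / (n : ℝ) ^ ((p : ℝ) / 2)))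
      atTop (𝓝 0) := by
    rw [show (0 : ℝ) = ∑ l ∈ D, C l * 0 by simp]
    refine tendsto_finsetSum _ fun l hl => Tendsto.const_mul _ ?_
    obtain ⟨-, hloop, hdeg, hconn⟩ := hD l hl
    exact tendsto_sum_prod_pairs hp hm (rowMultiplicity_self hloop)
      (fun u => by
        rw [sum_rowMultiplicity hdeg]
        exact hk u)
      (fun A hA h => hconn A hA fun e he => h _ _ (rowMultiplicity_ne_zero he))
      hρsymm hρ0 hρ1 (le_max_left _ _) hrow hfar
  refine squeeze_zero (fun n => div_nonneg (Finset.sum_nonneg fun t _ => abs_nonneg _)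
    (Real.rpow_nonneg (Nat.cast_nonneg n) _)) (fun n => ?_) hlim
  have hn0 : (0 : ℝ) ≤ (n : ℝ) ^ ((p : ℝ) / 2) := Real.rpow_nonneg (Nat.cast_nonneg n) _
  simp only [← mul_div_assoc]
  rw [← Finset.sum_div]
  refine div_le_div_of_nonneg_right ?_ hn0
  simp only [hT, Finset.mul_sum]
  rw [Finset.sum_comm]
  refine Finset.sum_le_sum fun t ht => ?_
  rw [Fintype.mem_piFinset] at ht
  refine (hbound (P n) (fun a => X n (t a.1) a.2) ?_ (fun a => hcent n _ (ht a.1) a.2)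
    (fun u i j => hstd n _ (ht u) i j)).trans (Finset.sum_le_sum fun l hl => ?_)
  · exact (hG n).hasGaussianLaw_comp (fun _ => hmeas n _ _)
      fun a : Fin p × Fin ν => ((⟨t a.1, ht a.1⟩, a.2) : Finset.Icc (1 : ℤ) (n : ℤ) × Fin ν)
  · exact mul_le_mul_of_nonneg_left
      (prod_abs_pow_le_prod_rows fun e => hrρ n _ (ht e.1.1) _ (ht e.2.1) (e.1.2, e.2.2))
      (hD l hl).1
end
end
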